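/- arXiv:2402.15661 — 3 statements merged into one kernel-verified Lean document; each statement's English description precedes it below -/
import Mathlib

section
/- Let X be a separable real Banach space with Property(M) such that ℓ₁ does not embed isomorphically into X. Then the dual X* has Property(M*). -/
open Filter Topology ZeroAtInfty

/-- A sequence converges weakly to zero. -/
def WeakNull {E : Type*} [NormedAddCommGroup E] [NormedSpace ℝ E] (x : ℕ → E) : Prop :=
  ∀ f : E →L[ℝ] ℝ, Tendsto (fun n => f (x n)) atTop (nhds 0)

/-- Property (M). -/
def PropertyM (E : Type*) [NormedAddCommGroup E] [NormedSpace ℝ E] : Prop :=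
  ∀ x : ℕ → E, WeakNull x → ∀ u v : E, ‖u‖ ≤ ‖v‖ →
    Filter.limsup (fun n => ‖x n + u‖) atTop ≤ Filter.limsup (fun n => ‖x n + v‖) atTop

/-- `F` embeds isomorphically into `E`. -/
def EmbedsIso (F E : Type*) [NormedAddCommGroup F] [NormedSpace ℝ F]
    [NormedAddCommGroup E] [NormedSpace ℝ E] : Prop :=
  ∃ T : F →L[ℝ] E, Function.Injective T ∧ ∃ c > (0 : ℝ), ∀ y, c * ‖y‖ ≤ ‖T y‖

/-- Weak normal structure. -/
def WeakNormalStructure (E : Type*) [NormedAddCommGroup E] [NormedSpace ℝ E] : Prop :=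
  ∀ C : Set E, Convex ℝ C → IsCompact (toWeakSpace ℝ E '' C) → C.Nontrivial →
    ∃ x ∈ C, sSup ((fun y => ‖x - y‖) '' C) < Metric.diam C

/-- Property (K). -/
def PropertyK (E : Type*) [NormedAddCommGroup E] [NormedSpace ℝ E] : Prop :=
  ∃ K : ℝ, 0 ≤ K ∧ K < 1 ∧ ∀ (x : ℕ → E) (y : E), WeakNull x →
    Tendsto (fun n => ‖x n‖) atTop (nhds 1) →
    Filter.liminf (fun n => ‖x n - y‖) atTop ≤ 1 → ‖y‖ ≤ K

/-- Kadec-Klee norm. -/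
def KadecKlee (E : Type*) [NormedAddCommGroup E] [NormedSpace ℝ E] : Prop :=
  ∀ (x : ℕ → E) (y : E),
    (∀ f : E →L[ℝ] ℝ, Tendsto (fun n => f (x n)) atTop (nhds (f y))) →
    Tendsto (fun n => ‖x n‖) atTop (nhds ‖y‖) →
    Tendsto (fun n => ‖x n - y‖) atTop (nhds 0)

/-- Opial's modulus. -/
noncomputable def opialModulus (E : Type*) [NormedAddCommGroup E] [NormedSpace ℝ E]
    (c : ℝ) : ℝ :=
  sInf { r : ℝ | ∃ (x : ℕ → E) (y : E), c ≤ ‖y‖ ∧ WeakNull x ∧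
    1 ≤ Filter.liminf (fun n => ‖x n‖) atTop ∧
    r = Filter.liminf (fun n => ‖x n - y‖) atTop - 1 }

/-- A sequence of functionals converges weak-star to zero. -/
def WeakStarNull {E : Type*} [NormedAddCommGroup E] [NormedSpace ℝ E]
    (f : ℕ → (E →L[ℝ] ℝ)) : Prop :=
  ∀ x : E, Tendsto (fun n => f n x) atTop (nhds 0)

/-- Property (M*) of the dual. -/
def PropertyMStar (E : Type*) [NormedAddCommGroup E] [NormedSpace ℝ E] : Prop :=
  ∀ f : ℕ → (E →L[ℝ] ℝ), WeakStarNull f → ∀ u v : E →L[ℝ] ℝ, ‖u‖ ≤ ‖v‖ →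
    Filter.limsup (fun n => ‖f n + u‖) atTop ≤ Filter.limsup (fun n => ‖f n + v‖) atTop

/-- Property (K*) of the dual. -/
def PropertyKStar (E : Type*) [NormedAddCommGroup E] [NormedSpace ℝ E] : Prop :=
  ∃ K : ℝ, 0 ≤ K ∧ K < 1 ∧ ∀ (f : ℕ → (E →L[ℝ] ℝ)) (g : E →L[ℝ] ℝ), WeakStarNull f →
    Tendsto (fun n => ‖f n‖) atTop (nhds 1) →
    Filter.liminf (fun n => ‖f n - g‖) atTop ≤ 1 → ‖g‖ ≤ K

/-- weak* Kadec-Klee norm on the dual. -/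
def WeakStarKadecKlee (E : Type*) [NormedAddCommGroup E] [NormedSpace ℝ E] : Prop :=
  ∀ (f : ℕ → (E →L[ℝ] ℝ)) (g : E →L[ℝ] ℝ),
    (∀ x : E, Tendsto (fun n => f n x) atTop (nhds (g x))) →
    Tendsto (fun n => ‖f n‖) atTop (nhds ‖g‖) →
    Tendsto (fun n => ‖f n - g‖) atTop (nhds 0)

/-- weak* Opial modulus of the dual. -/
noncomputable def weakStarOpialModulus (E : Type*) [NormedAddCommGroup E] [NormedSpace ℝ E]
    (c : ℝ) : ℝ :=
  sInf { r : ℝ | ∃ (f : ℕ → (E →L[ℝ] ℝ)) (g : E →L[ℝ] ℝ), c ≤ ‖g‖ ∧ WeakStarNull f ∧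
    1 ≤ Filter.liminf (fun n => ‖f n‖) atTop ∧
    r = Filter.liminf (fun n => ‖f n - g‖) atTop - 1 }

/-- WORTH* for the dual. -/
def WORTHStar (E : Type*) [NormedAddCommGroup E] [NormedSpace ℝ E] : Prop :=
  ∀ f : ℕ → (E →L[ℝ] ℝ), WeakStarNull f → ∀ g : E →L[ℝ] ℝ,
    Tendsto (fun n => ‖f n - g‖ - ‖f n + g‖) atTop (nhds 0)

/-- Reflexivity of a normed space. -/
def IsReflexive (E : Type*) [NormedAddCommGroup E] [NormedSpace ℝ E] : Prop :=
  Function.Surjective (NormedSpace.inclusionInDoubleDual ℝ E)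

/-- The fixed point property for nonexpansive maps. -/
def FPP (E : Type*) [NormedAddCommGroup E] [NormedSpace ℝ E] : Prop :=
  ∀ C : Set E, C.Nonempty → IsClosed C → Bornology.IsBounded C → Convex ℝ C →
    ∀ T : E → E, Set.MapsTo T C C →
      (∀ x ∈ C, ∀ y ∈ C, ‖T x - T y‖ ≤ ‖x - y‖) → ∃ x ∈ C, T x = x

/-- `E` contains an asymptotically isometric copy of `c₀`. -/
def ContainsAsympIsoC0 (E : Type*) [NormedAddCommGroup E] [NormedSpace ℝ E] : Prop :=
  ∃ ε : ℕ → ℝ, (∀ n, ε n ∈ Set.Ioo (0 : ℝ) 1) ∧ Tendsto ε atTop (nhds 0) ∧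
    ∃ x : ℕ → E, ∀ t : ℕ →₀ ℝ,
      (∀ n, (1 - ε n) * |t n| ≤ ‖∑ n ∈ t.support, t n • x n‖) ∧
      ‖∑ n ∈ t.support, t n • x n‖ ≤ ⨆ n, |t n|

/-- `E` contains an asymptotically isometric copy of `ℓ₁`. -/
def ContainsAsympIsoL1 (E : Type*) [NormedAddCommGroup E] [NormedSpace ℝ E] : Prop :=
  ∃ ε : ℕ → ℝ, (∀ n, ε n ∈ Set.Ioo (0 : ℝ) 1) ∧ Tendsto ε atTop (nhds 0) ∧
    ∃ x : ℕ → E, ∀ t : ℕ →₀ ℝ,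
      (∑ n ∈ t.support, (1 - ε n) * |t n| ≤ ‖∑ n ∈ t.support, t n • x n‖) ∧
      ‖∑ n ∈ t.support, t n • x n‖ ≤ ∑ n ∈ t.support, |t n|

/-- No point of `C` lies in infinitely many `A n` and in infinitely many `B n`, `n ∈ N`. -/
def SeparatedOn {K : Type*} (A B : ℕ → Set K) (C : Set K) (N : Set ℕ) : Prop :=
  ∀ f ∈ C, {n ∈ N | f ∈ A n}.Finite ∨ {n ∈ N | f ∈ B n}.Finite

/-- `C` is separated on no infinite subset of `N`. -/
def NowhereSeparated {K : Type*} (A B : ℕ → Set K) (C : Set K) (N : Set ℕ) : Prop :=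
  ∀ N' ⊆ N, N'.Infinite → ¬ SeparatedOn A B C N'

theorem SeparatedOn.of_diff_finite {K : Type*} {A B : ℕ → Set K} {C : Set K} {N N' : Set ℕ}
    (h : SeparatedOn A B C N) (hN : (N' \ N).Finite) : SeparatedOn A B C N' := by
  intro f hf
  have key : ∀ D : ℕ → Set K, {n ∈ N | f ∈ D n}.Finite → {n ∈ N' | f ∈ D n}.Finite := by
    intro D hD
    refine (hD.union hN).subset ?_
    rintro n ⟨hn, hfn⟩
    by_cases hnN : n ∈ N
    · exact Or.inl ⟨hnN, hfn⟩
    · exact Or.inr ⟨hn, hnN⟩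
  exact (h f hf).imp (key A) (key B)

/-- A diagonal sequence through infinite sets chosen one after the other, where `R k n S` can be
arranged for the `k`-th index `n` and a set `S` containing all later indices. -/
theorem exists_strictMono_diagonal (R : ℕ → ℕ → Set ℕ → Prop) (N : Set ℕ) (hN : N.Infinite)
    (h : ∀ k n, ∀ N' ⊆ N, N'.Infinite → ∃ N'' ⊆ N', N''.Infinite ∧ R k n N'') :
    ∃ (m : ℕ → ℕ) (S : ℕ → Set ℕ), StrictMono m ∧ (∀ k, m k ∈ N) ∧ (∀ k, R k (m k) (S k)) ∧
      ∀ k l, k < l → m l ∈ S k := by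
  have step : ∀ (k : ℕ) (P : {N' : Set ℕ // N' ⊆ N ∧ N'.Infinite}),
      ∃ (n : ℕ) (Q : {N' : Set ℕ // N' ⊆ N ∧ N'.Infinite}),
        n ∈ P.1 ∧ Q.1 ⊆ P.1 ∧ R k n Q.1 ∧ ∀ l ∈ Q.1, n < l := by
    rintro k ⟨P, hPN, hP⟩
    obtain ⟨n, hn⟩ := hP.nonempty
    have hP' : (P \ Set.Iic n).Infinite := hP.sdiff (Set.finite_Iic n)
    obtain ⟨Q, hQ, hQi, hR⟩ := h k n (P \ Set.Iic n) (Set.sdiff_subset.trans hPN) hP'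
    exact ⟨n, ⟨Q, hQ.trans (Set.sdiff_subset.trans hPN), hQi⟩, hn, hQ.trans Set.sdiff_subset, hR,
      fun l hl => not_le.1 (hQ hl).2⟩
  choose nx Q hmem hsub hR hlt using step
  let P : ℕ → {N' : Set ℕ // N' ⊆ N ∧ N'.Infinite} :=
    fun k => Nat.rec ⟨N, subset_rfl, hN⟩ (fun k P => Q k P) k
  have hPs : ∀ k, P (k + 1) = Q k (P k) := fun k => rfl
  have hanti : Antitone fun k => (P k).1 := antitone_nat_of_succ_le fun k => by
    simpa only [hPs] using hsub k (P k)
  refine ⟨fun k => nx k (P k), fun k => (P (k + 1)).1, strictMono_nat_of_lt_succ fun k => ?_,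
    fun k => (P k).2.1 (hmem _ _), fun k => hR k (P k), fun k l hkl => ?_⟩
  · exact hlt k (P k) _ (hmem (k + 1) (P (k + 1)))
  · exact hanti (Nat.succ_le_of_lt hkl) (hmem l (P l))

theorem exists_nowhereSeparated_inter {K : Type*} {A B : ℕ → Set K} {F : Set (Set K)}
    (hF : F.Finite) {N : Set ℕ} (hN : N.Infinite) (h : ∀ C ∈ F, NowhereSeparated A B C N) :
    ∃ n, ∃ N' : Set ℕ, N'.Infinite ∧
      ∀ C ∈ F, NowhereSeparated A B (C ∩ A n) N' ∧ NowhereSeparated A B (C ∩ B n) N' := by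
  by_contra! hcon
  have step : ∀ k n : ℕ, ∀ N' ⊆ N, N'.Infinite → ∃ N'' ⊆ N', N''.Infinite ∧
      ∃ C ∈ F, SeparatedOn A B (C ∩ A n) N'' ∨ SeparatedOn A B (C ∩ B n) N'' := by
    intro _ n N' _ hN'i
    obtain ⟨C, hC, hC'⟩ := hcon n N' hN'i
    by_cases hA : NowhereSeparated A B (C ∩ A n) N'
    · have hB := hC' hA
      unfold NowhereSeparated at hB
      push Not at hB
      obtain ⟨N'', h1, h2, h3⟩ := hB
      exact ⟨N'', h1, h2, C, hC, Or.inr h3⟩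
    · unfold NowhereSeparated at hA
      push Not at hA
      obtain ⟨N'', h1, h2, h3⟩ := hA
      exact ⟨N'', h1, h2, C, hC, Or.inl h3⟩
  obtain ⟨m, S, hm, hmN, hR, hS⟩ := exists_strictMono_diagonal _ N hN step
  choose C hCF hsep using hR
  have hside : ∀ k, ∃ b : Bool, SeparatedOn A B (C k ∩ (bif b then A else B) (m k)) (S k) :=
    fun k => (hsep k).elim (fun h => ⟨true, h⟩) (fun h => ⟨false, h⟩)
  choose b hb using hside
  have : Finite F := hF
  obtain ⟨⟨⟨C₀, hC₀⟩, b₀⟩, hfib⟩ :=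
    Finite.exists_infinite_fiber (fun k => ((⟨C k, hCF k⟩ : F), b k))
  rw [Set.infinite_coe_iff] at hfib
  set J := (fun k => ((⟨C k, hCF k⟩ : F), b k)) ⁻¹' {(⟨C₀, hC₀⟩, b₀)} with hJ
  have hJC : ∀ k ∈ J, C k = C₀ ∧ b k = b₀ := by
    intro k hk
    simpa [hJ] using hk
  refine h C₀ hC₀ (m '' J) (by rintro _ ⟨k, -, rfl⟩; exact hmN k)
    (hfib.image hm.injective.injOn) fun f hf => ?_
  by_cases hex : ∃ k ∈ J, f ∈ (bif b₀ then A else B) (m k)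
  · obtain ⟨k, hk, hfk⟩ := hex
    have := hb k
    rw [(hJC k hk).1, (hJC k hk).2] at this
    refine this.of_diff_finite (((Set.finite_Iic k).image m).subset ?_) f ⟨hf, hfk⟩
    rintro _ ⟨⟨l, -, rfl⟩, hl⟩
    exact ⟨l, not_lt.1 fun hkl => hl (hS k l hkl), rfl⟩
  · push Not at hex
    cases b₀
    · right
      convert Set.finite_empty
      ext n
      simp only [Set.mem_ofPred_eq, Set.mem_empty_iff_false, iff_false]
      rintro ⟨⟨k, hk, rfl⟩, hfk⟩
      exact hex k hk hfk
    · left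
      convert Set.finite_empty
      ext n
      simp only [Set.mem_ofPred_eq, Set.mem_empty_iff_false, iff_false]
      rintro ⟨⟨k, hk, rfl⟩, hfk⟩
      exact hex k hk hfk

/-- If no subsequence separates, some subsequence of the pairs `(A n, B n)` is independent. -/
theorem NowhereSeparated.exists_independent {K : Type*} {A B : ℕ → Set K} {N : Set ℕ}
    (hN : N.Infinite) (h : NowhereSeparated A B Set.univ N) :
    ∃ m : ℕ → ℕ, ∀ (σ : ℕ → Prop) (k : ℕ), ∃ f : K,
      ∀ i < k, (σ i → f ∈ A (m i)) ∧ (¬ σ i → f ∈ B (m i)) := by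
  let State := {p : Set (Set K) × Set ℕ //
    p.1.Finite ∧ p.2.Infinite ∧ ∀ C ∈ p.1, NowhereSeparated A B C p.2}
  have step : ∀ p : State, ∃ (n : ℕ) (q : State),
      ∀ C ∈ p.1.1, C ∩ A n ∈ q.1.1 ∧ C ∩ B n ∈ q.1.1 := by
    rintro ⟨⟨F, N⟩, hF, hN, hFN⟩
    obtain ⟨n, N', hN', hn⟩ := exists_nowhereSeparated_inter hF hN hFN
    refine ⟨n, ⟨⟨(fun C => C ∩ A n) '' F ∪ (fun C => C ∩ B n) '' F, N'⟩,
      (hF.image _).union (hF.image _), hN', ?_⟩,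
      fun C hC => ⟨Or.inl ⟨C, hC, rfl⟩, Or.inr ⟨C, hC, rfl⟩⟩⟩
    rintro _ (⟨C, hC, rfl⟩ | ⟨C, hC, rfl⟩)
    exacts [(hn C hC).1, (hn C hC).2]
  choose nx q hq using step
  let P : ℕ → State := fun k => Nat.rec
    ⟨({Set.univ}, N), Set.finite_singleton _, hN, by simpa using h⟩ (fun _ p => q p) k
  refine ⟨fun k => nx (P k), fun σ k => ?_⟩
  have hmem : ∀ k, ∃ C ∈ (P k).1.1, ∀ f ∈ C,
      ∀ i < k, (σ i → f ∈ A (nx (P i))) ∧ (¬ σ i → f ∈ B (nx (P i))) := by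
    intro k
    induction k with
    | zero => exact ⟨Set.univ, rfl, by simp⟩
    | succ k ih =>
      obtain ⟨C, hC, hCf⟩ := ih
      by_cases hσ : σ k
      · refine ⟨C ∩ A (nx (P k)), (hq (P k) C hC).1, fun f hf i hi => ?_⟩
        rcases Nat.lt_succ_iff_lt_or_eq.1 hi with hi | rfl
        · exact hCf f hf.1 i hi
        · exact ⟨fun _ => hf.2, fun h => absurd hσ h⟩
      · refine ⟨C ∩ B (nx (P k)), (hq (P k) C hC).2, fun f hf i hi => ?_⟩
        rcases Nat.lt_succ_iff_lt_or_eq.1 hi with hi | rfl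
        · exact hCf f hf.1 i hi
        · exact ⟨fun h => absurd h hσ, fun _ => hf.2⟩
  obtain ⟨C, hC, hCf⟩ := hmem k
  have hne : ∃ f, f ∈ C := by
    by_contra! hempty
    exact (P k).2.2.2 C hC _ subset_rfl (P k).2.2.1 fun f hf => absurd hf (hempty f)
  exact hne.imp hCf

theorem embedsIso_lp_one_of_lower_bound {X : Type*} [NormedAddCommGroup X] [NormedSpace ℝ X]
    [CompleteSpace X] {y : ℕ → X} (hy : ∀ i, ‖y i‖ ≤ 1) {δ : ℝ} (hδ : 0 < δ)
    (h : ∀ (t : ℕ → ℝ) (k : ℕ),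
      δ * ∑ i ∈ Finset.range k, |t i| ≤ ‖∑ i ∈ Finset.range k, t i • y i‖) :
    EmbedsIso (lp (fun _ : ℕ => ℝ) 1) X := by
  have hnorm : ∀ t : lp (fun _ : ℕ => ℝ) 1, HasSum (fun i => |t i|) ‖t‖ := fun t => by
    simpa using lp.hasSum_norm (p := 1) (by simp) t
  have hle : ∀ (t : lp (fun _ : ℕ => ℝ) 1) i, ‖t i • y i‖ ≤ |t i| := fun t i => by
    rw [norm_smul, Real.norm_eq_abs]
    exact mul_le_of_le_one_right (abs_nonneg _) (hy i)
  have hsum : ∀ t : lp (fun _ : ℕ => ℝ) 1, Summable fun i => t i • y i := fun t =>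
    Summable.of_norm_bounded (hnorm t).summable (hle t)
  let T₀ : lp (fun _ : ℕ => ℝ) 1 →ₗ[ℝ] X :=
    { toFun := fun t => ∑' i, t i • y i
      map_add' := fun s t => by
        simp only [lp.coeFn_add, Pi.add_apply, add_smul]
        exact (hsum s).tsum_add (hsum t)
      map_smul' := fun a t => by
        simp only [lp.coeFn_smul, Pi.smul_apply, smul_eq_mul, mul_smul, RingHom.id_apply]
        exact (hsum t).tsum_const_smul a }
  let T := T₀.mkContinuous 1 fun t => by
    rw [one_mul]
    exact tsum_of_norm_bounded (hnorm t) (hle t)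
  have hT : ∀ t, δ * ‖t‖ ≤ ‖T t‖ := fun t =>
    le_of_tendsto_of_tendsto' ((hnorm t).tendsto_sum_nat.const_mul δ)
      (hsum t).hasSum.tendsto_sum_nat.norm fun k => h t k
  refine ⟨T, (injective_iff_map_eq_zero T).2 fun t ht => ?_, δ, hδ, hT⟩
  have := hT t
  rw [ht, norm_zero] at this
  exact norm_eq_zero.1 (le_antisymm (nonpos_of_mul_nonpos_right this hδ) (norm_nonneg t))

/-- Rosenthal's `ℓ₁` theorem: a bounded sequence in a space without `ℓ₁` has a weakly Cauchy
subsequence. -/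
theorem exists_weaklyCauchy_subseq {X : Type*} [NormedAddCommGroup X] [NormedSpace ℝ X]
    [CompleteSpace X] (hl : ¬ EmbedsIso (lp (fun _ : ℕ => ℝ) 1) X) {x : ℕ → X}
    (hx : ∀ n, ‖x n‖ ≤ 1) :
    ∃ m : ℕ → ℕ, StrictMono m ∧
      ∀ f : X →L[ℝ] ℝ, ∃ l, Tendsto (fun k => f (x (m k))) atTop (𝓝 l) := by
  let K := {f : X →L[ℝ] ℝ // ‖f‖ ≤ 1}
  let A : ℝ → ℕ → Set K := fun r n => {f | f.1 (x n) < r}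
  let B : ℝ → ℕ → Set K := fun s n => {f | s < f.1 (x n)}
  have hsep : ∀ r s : ℝ, r < s → ∀ N : Set ℕ, N.Infinite →
      ¬ NowhereSeparated (A r) (B s) Set.univ N := by
    intro r s hrs N hN hnow
    obtain ⟨m, hm⟩ := hnow.exists_independent hN
    refine hl (embedsIso_lp_one_of_lower_bound (y := fun i => x (m i)) (fun i => hx _)
      (half_pos (sub_pos.2 hrs)) fun t k => ?_)
    obtain ⟨f, hf⟩ := hm (fun i => t i < 0) k
    obtain ⟨g, hg⟩ := hm (fun i => ¬ t i < 0) k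
    have hterm : ∀ i ∈ Finset.range k,
        (s - r) * |t i| ≤ t i * (f.1 (x (m i)) - g.1 (x (m i))) := by
      intro i hi
      have hfi := hf i (Finset.mem_range.1 hi)
      have hgi := hg i (Finset.mem_range.1 hi)
      by_cases ht : t i < 0
      · have h1 : f.1 (x (m i)) < r := hfi.1 ht
        have h2 : s < g.1 (x (m i)) := hgi.2 (not_not.2 ht)
        rw [abs_of_neg ht]
        nlinarith
      · have h1 : s < f.1 (x (m i)) := hfi.2 ht
        have h2 : g.1 (x (m i)) < r := hgi.1 ht
        rw [abs_of_nonneg (not_lt.1 ht)]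
        nlinarith [not_lt.1 ht]
    set w := ∑ i ∈ Finset.range k, t i • x (m i) with hw
    have hfg : ∑ i ∈ Finset.range k, t i * (f.1 (x (m i)) - g.1 (x (m i))) = f.1 w - g.1 w := by
      simp only [hw, map_sum, map_smul, smul_eq_mul, mul_sub, Finset.sum_sub_distrib]
    have hsum := Finset.sum_le_sum hterm
    rw [hfg, ← Finset.mul_sum] at hsum
    have hfw : f.1 w ≤ ‖w‖ := (le_abs_self _).trans
      ((f.1.le_opNorm w).trans (mul_le_of_le_one_left (norm_nonneg _) f.2))
    have hgw : -g.1 w ≤ ‖w‖ := (neg_le_abs _).trans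
      ((g.1.le_opNorm w).trans (mul_le_of_le_one_left (norm_nonneg _) g.2))
    linarith
  obtain ⟨e, he⟩ := exists_surjective_nat (ℚ × ℚ)
  obtain ⟨m, S, hm, -, hR, hS⟩ := exists_strictMono_diagonal
    (fun k _ N => ((e k).1 : ℝ) < (e k).2 →
      SeparatedOn (A (e k).1) (B (e k).2) Set.univ N) Set.univ Set.infinite_univ (by
    intro k _ N' _ hN'
    by_cases hk : ((e k).1 : ℝ) < (e k).2
    · have := hsep _ _ hk N' hN'
      unfold NowhereSeparated at this
      push Not at this
      obtain ⟨N'', h1, h2, h3⟩ := this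
      exact ⟨N'', h1, h2, fun _ => h3⟩
    · exact ⟨N', subset_rfl, hN', fun h => absurd h hk⟩)
  refine ⟨m, hm, fun f => ?_⟩
  have hball : ∀ f : K, ∃ l, Tendsto (fun k => f.1 (x (m k))) atTop (𝓝 l) := by
    intro f
    have hbd : ∀ k, |f.1 (x (m k))| ≤ 1 := fun k =>
      (f.1.le_opNorm _).trans (mul_le_one₀ f.2 (norm_nonneg _) (hx _))
    refine tendsto_of_no_upcrossings (s := Set.range ((↑) : ℚ → ℝ)) Rat.denseRange_cast ?_
      (isBoundedUnder_of ⟨1, fun k => (abs_le.1 (hbd k)).2⟩)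
      (isBoundedUnder_of ⟨-1, fun k => (abs_le.1 (hbd k)).1⟩)
    rintro _ ⟨r, rfl⟩ _ ⟨s, rfl⟩ hrs ⟨hA, hB⟩
    obtain ⟨k, hk⟩ := he (r, s)
    have hRk := hR k
    simp only [hk] at hRk
    have hRk' := (hRk hrs).of_diff_finite (N' := Set.range m) (((Set.finite_Iic k).image m).subset
      (by
        rintro _ ⟨⟨l, rfl⟩, hl⟩
        exact ⟨l, not_lt.1 fun hkl => hl (hS k l hkl), rfl⟩)) f (Set.mem_univ _)
    have hinf : ∀ p : ℕ → Prop, (∃ᶠ k in atTop, p (m k)) → {n ∈ Set.range m | p n}.Infinite := by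
      intro p hp
      refine ((Nat.frequently_atTop_iff_infinite.1 hp).image hm.injective.injOn).mono ?_
      rintro _ ⟨j, hj, rfl⟩
      exact ⟨⟨j, rfl⟩, hj⟩
    exact hRk'.elim (hinf (fun n => f.1 (x n) < r) hA) (hinf (fun n => (s : ℝ) < f.1 (x n)) hB)
  obtain ⟨l, hl'⟩ := hball ⟨(‖f‖ + 1)⁻¹ • f, by
    rw [norm_smul, norm_inv, Real.norm_of_nonneg (by positivity)]
    exact inv_mul_le_one_of_le₀ (by linarith) (by positivity)⟩
  refine ⟨(‖f‖ + 1) * l, (hl'.const_mul (‖f‖ + 1)).congr fun k => ?_⟩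
  have : ‖f‖ + 1 ≠ 0 := by positivity
  simp [this]

theorem PropertyM.eventually_norm_add_lt {X : Type*} [NormedAddCommGroup X] [NormedSpace ℝ X]
    (hM : PropertyM X) {d : ℕ → X} (hd : WeakNull d) {u v : X} (huv : ‖u‖ ≤ ‖v‖) {a b : ℝ}
    (ha : ∀ᶠ j in atTop, ‖d j + v‖ ≤ a) (hab : a < b) : ∀ᶠ j in atTop, ‖d j + u‖ < b := by
  have hbdd : IsBoundedUnder (· ≤ ·) atTop fun j => ‖d j + u‖ := by
    refine isBoundedUnder_of_eventually_le (a := a + ‖u - v‖) (ha.mono fun j hj => ?_)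
    calc ‖d j + u‖ = ‖(d j + v) + (u - v)‖ := by congr 1; abel
      _ ≤ a + ‖u - v‖ := (norm_add_le _ _).trans (by gcongr)
  refine eventually_lt_of_limsup_lt (((hM d hd u v huv).trans ?_).trans_lt hab) hbdd
  exact limsup_le_of_le (isCoboundedUnder_le_of_le atTop fun j => norm_nonneg _) ha

/-- A weakly null sequence cannot add a fixed amount to the norm of every vector. -/
theorem not_weakNull_of_eventually_le_norm_add {X : Type*} [NormedAddCommGroup X]
    [NormedSpace ℝ X] {d : ℕ → X} {M : ℝ} (hd : ∀ j, ‖d j‖ ≤ M) {κ : ℝ} (hκ : 0 < κ)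
    (h : ∀ z, ∀ᶠ j in atTop, ‖z‖ + κ ≤ ‖z + d j‖) : ¬ WeakNull d := by
  intro hnull
  let F : Set (Set ℕ) := {J | ∀ y ∈ convexHull ℝ (d '' J), κ / 2 < ‖y‖}
  have hF : Order.IsOfFiniteCharacter F := by
    refine fun J => ⟨fun hJ J' hJ' _ y hy => hJ y (convexHull_mono (Set.image_mono hJ') hy),
      fun hJ y hy => ?_⟩
    rw [convexHull_eq_union_convexHull_finite_subsets] at hy
    simp only [Set.mem_iUnion] at hy
    obtain ⟨t, ht, hy⟩ := hy
    classical
    obtain ⟨J', hJ', rfl⟩ := Finset.subset_set_image_iff.1 ht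
    exact hJ J' hJ' J'.finite_toSet y (by simpa using hy)
  obtain ⟨J, -, hJ⟩ := hF.exists_maximal (x := ∅) (by intro y hy; simp at hy)
  have hJinf : J.Infinite := by
    intro hfin
    have hcomp : IsCompact (convexHull ℝ (d '' J) ×ˢ Set.Icc (0 : ℝ) 1) :=
      (Set.Finite.isCompact_convexHull (𝕜 := ℝ) (hfin.image d)).prod isCompact_Icc
    have hev : ∀ᶠ j in atTop, ∀ p ∈ convexHull ℝ (d '' J) ×ˢ Set.Icc (0 : ℝ) 1,
        κ / 2 < ‖(1 - p.2) • p.1 + p.2 • d j‖ := by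
      have : ∀ p ∈ convexHull ℝ (d '' J) ×ˢ Set.Icc (0 : ℝ) 1,
          ∀ᶠ r : ℕ × (X × ℝ) in atTop ×ˢ 𝓝 p,
            κ / 2 < ‖(1 - r.2.2) • r.2.1 + r.2.2 • d r.1‖ := by
        rintro ⟨y, s⟩ ⟨hy, hs0, hs1⟩
        simp only at hy hs0 hs1
        have hy2 : κ / 2 < ‖y‖ := hJ.prop y hy
        have h1 : ∀ᶠ j in atTop, (1 - s) * ‖y‖ + s * κ ≤ ‖(1 - s) • y + s • d j‖ := by
          rcases hs0.eq_or_lt with rfl | hs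
          · simp
          · filter_upwards [h (((1 - s) / s) • y)] with j hj
            have e : (1 - s) • y + s • d j = s • (((1 - s) / s) • y + d j) := by
              rw [smul_add, smul_smul, mul_div_cancel₀ _ hs.ne']
            rw [e, norm_smul, Real.norm_of_nonneg hs0]
            rw [norm_smul, Real.norm_of_nonneg (div_nonneg (by linarith) hs0)] at hj
            calc (1 - s) * ‖y‖ + s * κ = s * ((1 - s) / s * ‖y‖ + κ) := by field_simp
              _ ≤ _ := by gcongr
        have hlow : κ / 2 < (1 - s) * ‖y‖ + s * κ := by
          rcases hs0.eq_or_lt with rfl | hs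
          · simpa using hy2
          · nlinarith
        have hcont : Tendsto (fun r : X × ℝ =>
            ‖(1 - r.2) • r.1 - (1 - s) • y‖ + |r.2 - s| * M) (𝓝 (y, s)) (𝓝 0) := by
          have : Continuous fun r : X × ℝ =>
            ‖(1 - r.2) • r.1 - (1 - s) • y‖ + |r.2 - s| * M := by fun_prop
          simpa using this.tendsto (y, s)
        have h2 := hcont.eventually (gt_mem_nhds (sub_pos.2 hlow))
        filter_upwards [h1.prod_mk h2] with ⟨j, y', s'⟩ ⟨hj, hr⟩
        simp only at hj hr ⊢
        have e : (1 - s) • y + s • d j =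
            ((1 - s') • y' + s' • d j) - ((1 - s') • y' - (1 - s) • y) - (s' - s) • d j := by
          rw [sub_smul s']; abel
        have e1 := norm_sub_le (((1 - s') • y' + s' • d j) - ((1 - s') • y' - (1 - s) • y))
          ((s' - s) • d j)
        have e2 := norm_sub_le ((1 - s') • y' + s' • d j) ((1 - s') • y' - (1 - s) • y)
        have e3 : ‖(s' - s) • d j‖ ≤ |s' - s| * M := by
          rw [norm_smul, Real.norm_eq_abs]
          gcongr
          exact hd j
        rw [← e] at e1
        linarith
      have := hcomp.mem_prod_nhdsSet_of_forall
        (s := {r : ℕ × (X × ℝ) | κ / 2 < ‖(1 - r.2.2) • r.2.1 + r.2.2 • d r.1‖}) this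
      exact (Filter.Eventually.curry this).mono fun _ h => h.self_of_nhdsSet
    obtain ⟨j, hjJ, hj0, hj⟩ : ∃ j, j ∉ J ∧ ‖(0 : X)‖ + κ ≤ ‖0 + d j‖ ∧
        ∀ p ∈ convexHull ℝ (d '' J) ×ˢ Set.Icc (0 : ℝ) 1,
          κ / 2 < ‖(1 - p.2) • p.1 + p.2 • d j‖ := by
      have hJc : ∀ᶠ j in atTop, j ∉ J := by
        simpa [Nat.cofinite_eq_atTop] using hfin.eventually_cofinite_notMem
      exact (hJc.and ((h 0).and hev)).exists
    refine hjJ (hJ.le_of_ge (y := insert j J) ?_ (Set.subset_insert _ _) (Set.mem_insert _ _))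
    intro y hy
    rw [Set.image_insert_eq] at hy
    rcases J.eq_empty_or_nonempty with rfl | hne
    · simp only [Set.image_empty, insert_empty_eq, convexHull_singleton,
        Set.mem_singleton_iff] at hy
      subst hy
      simp only [norm_zero, zero_add] at hj0
      linarith
    · rw [convexHull_insert (hne.image d), mem_convexJoin] at hy
      obtain ⟨_, rfl, w, hw, hyw⟩ := hy
      obtain ⟨a, b, ha, hb, hab, rfl⟩ := hyw
      have := hj (w, a) ⟨hw, ha, by linarith⟩
      rwa [show 1 - (w, a).2 = b by simp only; linarith, add_comm] at this
  obtain ⟨f, u, hfb, hfJ⟩ := geometric_hahn_banach_open (convex_ball (0 : X) (κ / 2))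
    Metric.isOpen_ball (convex_convexHull ℝ (d '' J)) (by
      rw [Set.disjoint_left]
      intro y hy hyJ
      exact (hJ.prop y hyJ).not_ge (mem_ball_zero_iff.1 hy).le)
  have hu : 0 < u := by simpa using hfb 0 (Metric.mem_ball_self (half_pos hκ))
  have hfreq : ∃ᶠ j in atTop, j ∈ J := Nat.frequently_atTop_iff_infinite.2 hJinf
  obtain ⟨j, hj, hju⟩ := (hfreq.and_eventually ((hnull f).eventually (gt_mem_nhds hu))).exists
  exact (hfJ _ (subset_convexHull ℝ _ ⟨j, hj, rfl⟩)).not_gt hju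

/-- A sequence on which every functional converges. -/
def WeakCauchy {X : Type*} [NormedAddCommGroup X] [NormedSpace ℝ X] (x : ℕ → X) : Prop :=
  ∀ f : X →L[ℝ] ℝ, ∃ l, Tendsto (fun n => f (x n)) atTop (𝓝 l)

theorem WeakNull.comp {X : Type*} [NormedAddCommGroup X] [NormedSpace ℝ X] {d : ℕ → X}
    (hd : WeakNull d) {φ : ℕ → ℕ} (hφ : Tendsto φ atTop atTop) : WeakNull (d ∘ φ) :=
  fun f => (hd f).comp hφ

theorem PropertyM.exists_norm_add_sub_le {X : Type*} [NormedAddCommGroup X] [NormedSpace ℝ X]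
    (hM : PropertyM X) {x : ℕ → X} (hx : ∀ n, ‖x n‖ ≤ 1) (hc : WeakCauchy x) {κ : ℝ}
    (hκ : 0 < κ) :
    ∃ T : ℝ, ∀ z : X, T ≤ ‖z‖ → ∀ m₀, ∃ i ≥ m₀, ∀ m, ∃ n ≥ m, ‖z + (x i - x n)‖ ≤ ‖z‖ + κ := by
  by_contra! hcon
  choose z hz m₀ hm₀ using fun T : ℕ => hcon T
  choose! p hp using hm₀
  have hn : ∀ i, ∃ n ≥ i, ∀ T ≤ i, m₀ T ≤ i → ‖z T‖ + κ < ‖z T + (x i - x n)‖ := by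
    intro i
    refine ⟨max i ((Finset.range (i + 1)).sup fun T => p T i), le_max_left _ _,
      fun T hT hTi => hp T i hTi _ (le_max_of_le_right ?_)⟩
    exact Finset.le_sup (f := fun T => p T i) (Finset.mem_range.2 (Nat.lt_succ_of_le hT))
  choose n hni hn using hn
  set d : ℕ → X := fun i => x i - x (n i) with hd
  have hnull : WeakNull d := by
    intro f
    obtain ⟨l, hl⟩ := hc f
    simpa [hd] using hl.sub (hl.comp (tendsto_atTop_mono hni tendsto_id))
  have hdz : ∀ T, ∀ᶠ i in atTop, ‖z T‖ + κ < ‖z T + d i‖ := fun T => by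
    filter_upwards [eventually_ge_atTop T, eventually_ge_atTop (m₀ T)] with i h1 h2
    exact hn i T h1 h2
  refine not_weakNull_of_eventually_le_norm_add (d := d) (M := 2) (κ := κ / 2)
    (fun j => (norm_sub_le _ _).trans (by linarith [hx j, hx (n j)])) (half_pos hκ)
    (fun w => ?_) hnull
  by_contra hw
  have hfr : ∃ᶠ i in atTop, ‖w + d i‖ < ‖w‖ + κ / 2 := by
    simpa only [not_eventually, not_le] using hw
  obtain ⟨φ, hφ, hφw⟩ := extraction_of_frequently_atTop hfr
  obtain ⟨T, hT⟩ := exists_nat_ge ‖w‖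
  have hwT : ‖w‖ ≤ ‖z T‖ := hT.trans (hz T)
  obtain ⟨w', hw', hww'⟩ : ∃ w', ‖w'‖ = ‖z T‖ ∧ ‖w' - w‖ = ‖z T‖ - ‖w‖ := by
    rcases eq_or_ne w 0 with rfl | hw0
    · exact ⟨z T, rfl, by simp⟩
    · have hpos : 0 < ‖w‖ := norm_pos_iff.2 hw0
      refine ⟨(‖z T‖ / ‖w‖) • w, ?_, ?_⟩
      · rw [norm_smul, Real.norm_of_nonneg (by positivity), div_mul_cancel₀ _ hpos.ne']
      · have e : (‖z T‖ / ‖w‖) • w - w = ((‖z T‖ - ‖w‖) / ‖w‖) • w := by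
          rw [sub_div, div_self hpos.ne', sub_smul, one_smul]
        rw [e, norm_smul, Real.norm_of_nonneg (div_nonneg (sub_nonneg.2 hwT) hpos.le),
          div_mul_cancel₀ _ hpos.ne']
  have h1 : ∀ᶠ j in atTop, ‖(d ∘ φ) j + w'‖ ≤ ‖z T‖ + κ / 2 := Eventually.of_forall fun j => by
    have e : (d ∘ φ) j + w' = (w + d (φ j)) + (w' - w) := by
      simp only [Function.comp_apply]; abel
    rw [e]
    linarith [norm_add_le (w + d (φ j)) (w' - w), hφw j]
  have h2 := hM.eventually_norm_add_lt (hnull.comp hφ.tendsto_atTop) hw'.ge h1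
    (show _ < ‖z T‖ + κ by linarith)
  obtain ⟨j, hj1, hj2⟩ := (h2.and (hφ.tendsto_atTop.eventually (hdz T))).exists
  rw [Function.comp_apply, add_comm] at hj1
  exact hj1.not_gt hj2

/-- The set `C m` eventually bounds `F` from below by nearly `q`, and `F` takes values
arbitrarily close to `q` on every `C m`. -/
def IsTailInf {α : Type*} (C : ℕ → Set α) (F : α → ℝ) (q : ℝ) : Prop :=
  (∀ ε > 0, ∃ m, ∀ c ∈ C m, q - ε < F c) ∧ ∀ ε > 0, ∀ m, ∃ c ∈ C m, F c < q + ε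

theorem exists_isTailInf {α : Type*} {C : ℕ → Set α} (hC : Antitone C)
    (hne : ∀ m, (C m).Nonempty) {F : α → ℝ} {a b : ℝ} (hF : ∀ c ∈ C 0, F c ∈ Set.Icc a b) :
    ∃ q, IsTailInf C F q := by
  set S : Set ℝ := {r | ∃ m, ∀ c ∈ C m, r ≤ F c} with hS
  have hSne : S.Nonempty := ⟨a, 0, fun c hc => (hF c hc).1⟩
  have hSb : BddAbove S := by
    refine ⟨b, ?_⟩
    rintro r ⟨m, hr⟩
    obtain ⟨c, hc⟩ := hne m
    exact (hr c hc).trans (hF c (hC m.zero_le hc)).2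
  refine ⟨sSup S, fun ε hε => ?_, fun ε hε m => ?_⟩
  · obtain ⟨r, ⟨m, hr⟩, hlt⟩ := exists_lt_of_lt_csSup hSne (sub_lt_self (sSup S) hε)
    exact ⟨m, fun c hc => hlt.trans_le (hr c hc)⟩
  · by_contra! h
    linarith [le_csSup hSb ⟨m, h⟩]

section AsympNorm

variable {X : Type*} [NormedAddCommGroup X]

/-- The asymptotic distance of a sequence to `-y`. -/
noncomputable def asympNorm (x : ℕ → X) (y : X) : ℝ := limsup (fun n => ‖x n + y‖) atTop

theorem asympNorm_le_of_eventually {x : ℕ → X} {y : X} {b : ℝ}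
    (h : ∀ᶠ n in atTop, ‖x n + y‖ ≤ b) : asympNorm x y ≤ b :=
  limsup_le_of_le (isCoboundedUnder_le_of_le atTop fun _ => norm_nonneg _) h

theorem frequently_lt_of_lt_asympNorm {x : ℕ → X} {y : X} {a : ℝ} (h : a < asympNorm x y) :
    ∃ᶠ n in atTop, a < ‖x n + y‖ :=
  frequently_lt_of_lt_limsup (isCoboundedUnder_le_of_le atTop fun _ => norm_nonneg _) h

theorem eventually_lt_of_asympNorm_lt {x : ℕ → X} (hx : ∀ n, ‖x n‖ ≤ 1) {y : X} {b : ℝ}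
    (h : asympNorm x y < b) :
    ∀ᶠ n in atTop, ‖x n + y‖ < b :=
  eventually_lt_of_limsup_lt h <| isBoundedUnder_of
    ⟨1 + ‖y‖, fun n => (norm_add_le _ _).trans (by gcongr; exact hx n)⟩

theorem asympNorm_le_one_add {x : ℕ → X} (hx : ∀ n, ‖x n‖ ≤ 1) (y : X) :
    asympNorm x y ≤ 1 + ‖y‖ :=
  asympNorm_le_of_eventually <| Eventually.of_forall fun n =>
    (norm_add_le _ _).trans (by gcongr; exact hx n)

theorem asympNorm_nonneg {x : ℕ → X} (hx : ∀ n, ‖x n‖ ≤ 1) (y : X) : 0 ≤ asympNorm x y := by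
  by_contra! h
  obtain ⟨n, hn⟩ := (eventually_lt_of_asympNorm_lt hx h).exists
  exact hn.not_ge (norm_nonneg _)

theorem asympNorm_le_add_norm_sub {x : ℕ → X} (hx : ∀ n, ‖x n‖ ≤ 1) (y y' : X) :
    asympNorm x y ≤ asympNorm x y' + ‖y - y'‖ := by
  refine le_of_forall_pos_le_add fun ε hε => asympNorm_le_of_eventually ?_
  filter_upwards [eventually_lt_of_asympNorm_lt hx (lt_add_of_pos_right (asympNorm x y') hε)]
    with n hn
  have e : x n + y = (x n + y') + (y - y') := by abel
  rw [e]
  linarith [norm_add_le (x n + y') (y - y')]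

end AsympNorm

section Tail

variable {X : Type*} [NormedAddCommGroup X] [NormedSpace ℝ X]

/-- The convex hull of the `m`-th tail of a sequence. -/
def tailHull (x : ℕ → X) (m : ℕ) : Set X := convexHull ℝ (x '' Set.Ici m)

theorem mem_tailHull (x : ℕ → X) {m n : ℕ} (h : m ≤ n) : x n ∈ tailHull x m :=
  subset_convexHull ℝ _ ⟨n, h, rfl⟩

theorem tailHull_antitone (x : ℕ → X) : Antitone (tailHull x) := fun _ _ h =>
  convexHull_mono (Set.image_mono (Set.Ici_subset_Ici.2 h))

theorem norm_le_of_mem_tailHull {x : ℕ → X} (hx : ∀ n, ‖x n‖ ≤ 1) {m : ℕ} {c : X}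
    (hc : c ∈ tailHull x m) : ‖c‖ ≤ 1 := by
  have : tailHull x m ⊆ Metric.closedBall 0 1 := by
    refine convexHull_min ?_ (convex_closedBall _ _)
    rintro _ ⟨n, -, rfl⟩
    simpa using hx n
  simpa using this hc

theorem tendsto_apply_of_mem_tailHull {x c : ℕ → X} (hc : ∀ j, c j ∈ tailHull x j)
    {f : X →L[ℝ] ℝ} {l : ℝ} (hl : Tendsto (fun n => f (x n)) atTop (𝓝 l)) :
    Tendsto (fun j => f (c j)) atTop (𝓝 l) := by
  rw [Metric.tendsto_atTop] at hl ⊢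
  intro ε hε
  obtain ⟨m, hm⟩ := hl (ε / 2) (half_pos hε)
  refine ⟨m, fun j hj => ?_⟩
  have : tailHull x j ⊆ f.toLinearMap ⁻¹' Metric.closedBall l (ε / 2) := by
    refine convexHull_min ?_ ((convex_closedBall _ _).linear_preimage f.toLinearMap)
    rintro _ ⟨n, hn, rfl⟩
    exact (hm n (hj.trans hn)).le
  have h2 : dist (f (c j)) l ≤ ε / 2 := this (hc j)
  linarith

theorem weakNull_sub_of_mem_tailHull {x c : ℕ → X} (hx : WeakCauchy x)
    (hc : ∀ j, c j ∈ tailHull x j) {n : ℕ → ℕ} (hn : ∀ j, j ≤ n j) :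
    WeakNull fun j => x (n j) - c j := by
  intro f
  obtain ⟨l, hl⟩ := hx f
  simpa using (hl.comp (tendsto_atTop_mono hn tendsto_id)).sub
    (tendsto_apply_of_mem_tailHull hc hl)

theorem one_add_mul_asympNorm_le {x : ℕ → X} (hx : ∀ n, ‖x n‖ ≤ 1) {s : ℝ} (hs : 0 ≤ s) (w : X) :
    (1 + s) * asympNorm x w ≤ asympNorm x ((1 + s) • w) + s := by
  have hs1 : 0 < 1 + s := by linarith
  refine le_of_forall_pos_le_add fun ε hε => ?_
  rw [← le_div_iff₀' hs1]
  refine asympNorm_le_of_eventually ?_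
  filter_upwards [eventually_lt_of_asympNorm_lt hx
    (lt_add_of_pos_right (asympNorm x ((1 + s) • w)) hε)] with n hn
  rw [le_div_iff₀' hs1]
  have e : (1 + s) • (x n + w) = (x n + (1 + s) • w) + s • x n := by module
  calc (1 + s) * ‖x n + w‖ = ‖(1 + s) • (x n + w)‖ := by
        rw [norm_smul, Real.norm_of_nonneg hs1.le]
    _ ≤ ‖x n + (1 + s) • w‖ + s * ‖x n‖ := by
        rw [e]
        refine (norm_add_le _ _).trans_eq ?_
        rw [norm_smul, Real.norm_of_nonneg hs]
    _ ≤ _ := by nlinarith [hx n]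

theorem exists_isTailInf_norm {x : ℕ → X} (hx : ∀ n, ‖x n‖ ≤ 1) :
    ∃ g, 0 ≤ g ∧ IsTailInf (tailHull x) (fun c => ‖c‖) g := by
  obtain ⟨g, hg⟩ := exists_isTailInf (tailHull_antitone x) (fun m => ⟨_, mem_tailHull x le_rfl⟩)
    (F := fun c => ‖c‖) (a := 0) (b := 1)
    fun c hc => ⟨norm_nonneg _, norm_le_of_mem_tailHull hx hc⟩
  refine ⟨g, ?_, hg⟩
  by_contra! h
  obtain ⟨c, -, hc⟩ := hg.2 (-g) (by linarith) 0
  linarith [norm_nonneg c]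

theorem exists_isTailInf_asympNorm {x : ℕ → X} (hx : ∀ n, ‖x n‖ ≤ 1) (z : X) :
    ∃ q, IsTailInf (tailHull x) (fun c => asympNorm x (z - c)) q :=
  exists_isTailInf (tailHull_antitone x) (fun m => ⟨_, mem_tailHull x le_rfl⟩)
    (a := 0) (b := 1 + (‖z‖ + 1)) fun c hc => ⟨asympNorm_nonneg hx _,
      (asympNorm_le_one_add hx _).trans (by
        gcongr
        exact (norm_sub_le _ _).trans (by gcongr; exact norm_le_of_mem_tailHull hx hc))⟩

theorem IsTailInf.le_add_norm_sub {x : ℕ → X} (hx : ∀ n, ‖x n‖ ≤ 1) {z z' : X} {q q' : ℝ}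
    (hq : IsTailInf (tailHull x) (fun c => asympNorm x (z - c)) q)
    (hq' : IsTailInf (tailHull x) (fun c => asympNorm x (z' - c)) q') :
    q ≤ q' + ‖z - z'‖ := by
  refine le_of_forall_pos_le_add fun ε hε => ?_
  obtain ⟨m, hm⟩ := hq.1 (ε / 2) (half_pos hε)
  obtain ⟨c, hc, hc'⟩ := hq'.2 (ε / 2) (half_pos hε) m
  have h1 := hm c hc
  have h2 := asympNorm_le_add_norm_sub hx (z - c) (z' - c)
  rw [sub_sub_sub_cancel_right] at h2
  simp only at h1 hc'
  linarith

theorem PropertyM.isTailInf_mono {x : ℕ → X} (hx : ∀ n, ‖x n‖ ≤ 1)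
    (hM : PropertyM X) (hc : WeakCauchy x) {z z' : X}
    (hz : ‖z‖ ≤ ‖z'‖) {q q' : ℝ}
    (hq : IsTailInf (tailHull x) (fun c => asympNorm x (z - c)) q)
    (hq' : IsTailInf (tailHull x) (fun c => asympNorm x (z' - c)) q') : q ≤ q' := by
  refine le_of_forall_pos_le_add fun ε hε => ?_
  have hδ : 0 < ε / 4 := by linarith
  choose c hcC hcN using hq'.2 (ε / 4) hδ
  have hn : ∀ j, ∃ n ≥ j, ‖x n + (z' - c j)‖ < q' + ε / 4 ∧
      asympNorm x (z - c j) - ε / 4 < ‖x n + (z - c j)‖ := fun j =>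
    let ⟨n, hn, h1, h2⟩ := ((frequently_lt_of_lt_asympNorm (sub_lt_self _ hδ)).and_eventually
      ((eventually_lt_of_asympNorm_lt hx (hcN j)).and (eventually_ge_atTop j))).exists
    ⟨n, h2, h1, hn⟩
  choose n hnj hn1 hn2 using hn
  have e : ∀ j w, x (n j) - c j + w = x (n j) + (w - c j) := fun j w => by abel
  have h1 := hM.eventually_norm_add_lt (weakNull_sub_of_mem_tailHull hc hcC hnj) hz
    (a := q' + ε / 4) (b := q' + ε / 2)
    (Eventually.of_forall fun j => by rw [e]; exact (hn1 j).le) (by linarith)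
  obtain ⟨m, hm⟩ := hq.1 (ε / 4) hδ
  obtain ⟨j, hj, hmj⟩ := (h1.and (eventually_ge_atTop m)).exists
  have h3 := hm (c j) (tailHull_antitone x hmj (hcC j))
  rw [e] at hj
  simp only at h3
  linarith [hn2 j]

theorem PropertyM.isTailInf_le_add {x : ℕ → X} (hx : ∀ n, ‖x n‖ ≤ 1)
    (hM : PropertyM X) (hc : WeakCauchy x) {w z : X} {ε : ℝ}
    (hz : z ≠ 0) (hε : 0 ≤ ε) (hw : ‖w‖ ≤ ‖z‖ + ε) {q q' : ℝ}
    (hq : IsTailInf (tailHull x) (fun c => asympNorm x (w - c)) q)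
    (hq' : IsTailInf (tailHull x) (fun c => asympNorm x (z - c)) q') : q ≤ q' + ε := by
  have hz0 : 0 < ‖z‖ := norm_pos_iff.2 hz
  set w' := (1 + ε / ‖z‖) • z with hw'
  obtain ⟨r, hr⟩ := exists_isTailInf_asympNorm hx w'
  have h1 : ‖w'‖ = ‖z‖ + ε := by
    rw [hw', norm_smul, Real.norm_of_nonneg (by positivity)]
    field_simp
  have h2 : ‖w' - z‖ = ε := by
    have e : w' - z = (ε / ‖z‖) • z := by rw [hw']; module
    rw [e, norm_smul, Real.norm_of_nonneg (by positivity), div_mul_cancel₀ _ hz0.ne']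
  have h3 := hM.isTailInf_mono hx hc (hw.trans_eq h1.symm) hq hr
  have h4 := hr.le_add_norm_sub hx hq'
  linarith

theorem PropertyM.isTailInf_le_one_of_norm_eq {x : ℕ → X} (hx : ∀ n, ‖x n‖ ≤ 1)
    (hM : PropertyM X) (hc : WeakCauchy x) {g : ℝ}
    (hg0 : 0 < g) (hg : IsTailInf (tailHull x) (fun c => ‖c‖) g) {z : X} (hz : ‖z‖ = g) {q : ℝ}
    (hq : IsTailInf (tailHull x) (fun c => asympNorm x (z - c)) q) : q ≤ 1 := by
  by_contra! hq1
  have hz0 : z ≠ 0 := norm_pos_iff.1 (hz ▸ hg0)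
  set κ := (q - 1) / 2 with hκ
  have hκ0 : 0 < κ := by linarith
  obtain ⟨T, hT⟩ := hM.exists_norm_add_sub_le hx hc hκ0
  set s := g / (2 * (|T| + 1)) with hs
  have hs0 : 0 < s := by positivity
  have hsT : s * T ≤ g / 2 := by
    have : s * (|T| + 1) = g / 2 := by rw [hs]; field_simp
    nlinarith [le_abs_self T]
  have h1s : 0 < 1 + s := by linarith
  set ε := min (g / 2) (s * κ / (12 * (1 + s))) with hε
  have hε0 : 0 < ε := by positivity
  have hεg : ε ≤ g / 2 := min_le_left _ _
  have hεs : ε ≤ s * κ / (12 * (1 + s)) := min_le_right _ _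
  have hconv : ∀ {m a b}, a ∈ tailHull x m → b ∈ tailHull x m →
      (1 + s)⁻¹ • (a + s • b) ∈ tailHull x m := by
    intro m a b ha hb
    rw [smul_add, smul_smul]
    refine convex_convexHull ℝ _ ha hb (by positivity) (by positivity) ?_
    field_simp
  obtain ⟨m₁, hm₁⟩ := hg.1 ε hε0
  obtain ⟨c₁, hc₁, hc₁g⟩ := hg.2 ε hε0 m₁
  have hc₁T : T ≤ ‖s⁻¹ • c₁‖ := by
    rw [norm_smul, Real.norm_of_nonneg (by positivity), ← div_eq_inv_mul, le_div_iff₀' hs0]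
    have := hm₁ c₁ hc₁
    simp only at this
    linarith
  obtain ⟨i, him, hi⟩ := hT _ hc₁T m₁
  set p := (1 + s)⁻¹ • (c₁ + s • x i) with hp
  have hpC : p ∈ tailHull x m₁ := hconv hc₁ (mem_tailHull x him)
  have hpg : g - ε < ‖p‖ := hm₁ p hpC
  obtain ⟨qp, hqp⟩ := exists_isTailInf_asympNorm hx p
  have hqqp : q ≤ qp + ε := hM.isTailInf_le_add hx hc
    (norm_pos_iff.1 (by linarith)) hε0.le (by linarith) hq hqp
  obtain ⟨m₂, hm₂⟩ := hqp.1 ε hε0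
  obtain ⟨n, hn, hin⟩ := hi m₂
  set y := c₁ + s • (x i - x n) with hy
  have hyn : ‖y‖ ≤ ‖z‖ + (ε + s * κ) := by
    have e : y = s • (s⁻¹ • c₁ + (x i - x n)) := by
      rw [smul_add, smul_inv_smul₀ hs0.ne']
    rw [norm_smul, norm_inv, Real.norm_of_nonneg hs0.le] at hin
    rw [e, norm_smul, Real.norm_of_nonneg hs0.le]
    calc _ ≤ s * (s⁻¹ * ‖c₁‖ + κ) := by gcongr
      _ = ‖c₁‖ + s * κ := by field_simp
      _ ≤ _ := by simp only at hc₁g; linarith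
  obtain ⟨qy, hqy⟩ := exists_isTailInf_asympNorm hx y
  have hqyq : qy ≤ q + (ε + s * κ) :=
    hM.isTailInf_le_add hx hc hz0 (by positivity) hyn hqy hq
  obtain ⟨c₂, hc₂, hc₂N⟩ := hqy.2 ε hε0 m₂
  have h1 := hm₂ _ (hconv hc₂ (mem_tailHull x hn))
  have h2 := one_add_mul_asympNorm_le hx hs0.le (p - (1 + s)⁻¹ • (c₂ + s • x n))
  have e : (1 + s) • (p - (1 + s)⁻¹ • (c₂ + s • x n)) = y - c₂ := by
    rw [smul_sub, hp, smul_inv_smul₀ h1s.ne', smul_inv_smul₀ h1s.ne', hy]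
    module
  rw [e] at h2
  simp only at h1 hc₂N
  have h3 : (1 + s) * (q - 2 * ε) ≤ q + 2 * ε + s * κ + s := by
    have : (1 + s) * (q - 2 * ε) ≤ (1 + s) * asympNorm x (p - (1 + s)⁻¹ • (c₂ + s • x n)) := by
      gcongr
      linarith
    linarith
  rw [le_div_iff₀ (by positivity)] at hεs
  nlinarith [mul_pos hs0 hκ0, mul_pos hs0 hε0]

theorem PropertyM.isTailInf_le_one {x : ℕ → X} (hx : ∀ n, ‖x n‖ ≤ 1)
    (hM : PropertyM X) (hc : WeakCauchy x) {g : ℝ}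
    (hg0 : 0 ≤ g) (hg : IsTailInf (tailHull x) (fun c => ‖c‖) g) {z : X} (hz : ‖z‖ ≤ g) {q : ℝ}
    (hq : IsTailInf (tailHull x) (fun c => asympNorm x (z - c)) q) : q ≤ 1 := by
  rcases hg0.eq_or_lt with rfl | hg0
  · obtain rfl : z = 0 := norm_le_zero_iff.1 hz
    refine le_of_forall_pos_le_add fun ε hε => ?_
    obtain ⟨m, hm⟩ := hq.1 (ε / 2) (half_pos hε)
    obtain ⟨c, hcC, hcε⟩ := hg.2 (ε / 2) (half_pos hε) m
    have h1 := hm c hcC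
    have h2 := asympNorm_le_one_add hx (0 - c)
    simp only [zero_sub, norm_neg, zero_add] at h1 h2 hcε
    linarith
  · obtain ⟨m, hm⟩ := hg.1 g hg0
    have hxm : 0 < ‖x m‖ := by simpa using hm _ (mem_tailHull x le_rfl)
    have hz' : ‖(g / ‖x m‖) • x m‖ = g := by
      rw [norm_smul, Real.norm_of_nonneg (by positivity), div_mul_cancel₀ _ hxm.ne']
    obtain ⟨q', hq'⟩ := exists_isTailInf_asympNorm hx ((g / ‖x m‖) • x m)
    exact (hM.isTailInf_mono hx hc (hz.trans_eq hz'.symm) hq hq').trans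
      (hM.isTailInf_le_one_of_norm_eq hx hc hg0 hg hz' hq')

end Tail

/-- In a space with Property (M), a weakly Cauchy sequence `x` in the unit ball has convex blocks
`c j` whose differences from `x`, translated by a suitable `z`, have asymptotic norm nearly at
most one, and `z` may be chosen so that `v z` is nearly as large as the limit of `u (x n)`. -/
theorem PropertyM.exists_weakNull_sub {X : Type*} [NormedAddCommGroup X] [NormedSpace ℝ X]
    (hM : PropertyM X) {x : ℕ → X} (hx : ∀ n, ‖x n‖ ≤ 1) (hc : WeakCauchy x)
    {u v : X →L[ℝ] ℝ} (huv : ‖u‖ ≤ ‖v‖) {l : ℝ} (hl : Tendsto (fun n => u (x n)) atTop (𝓝 l))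
    {ε : ℝ} (hε : 0 < ε) :
    ∃ z : X, l - ε < v z ∧ ∃ c : ℕ → X, (∀ j, c j ∈ tailHull x j) ∧
      ∀ j, asympNorm x (z - c j) < 1 + ε := by
  obtain ⟨g, hg0, hg⟩ := exists_isTailInf_norm hx
  have hlg : l ≤ g * ‖v‖ := by
    have key : ∀ δ > 0, l ≤ (g + δ) * ‖v‖ := fun δ hδ => by
      choose c hcC hcg using hg.2 δ hδ
      refine le_of_tendsto' (tendsto_apply_of_mem_tailHull hcC hl) fun j => ?_
      calc u (c j) ≤ ‖u (c j)‖ := Real.le_norm_self _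
        _ ≤ ‖u‖ * ‖c j‖ := u.le_opNorm _
        _ ≤ ‖v‖ * (g + δ) := by gcongr; exact (hcg j).le
        _ = _ := mul_comm _ _
    have hlim : Tendsto (fun δ : ℝ => (g + δ) * ‖v‖) (𝓝[>] 0) (𝓝 (g * ‖v‖)) := by
      have : Continuous fun δ : ℝ => (g + δ) * ‖v‖ := by fun_prop
      simpa using (this.tendsto 0).mono_left nhdsWithin_le_nhds
    exact ge_of_tendsto hlim (eventually_nhdsWithin_of_forall key)
  obtain ⟨z, hzg, hz⟩ : ∃ z, ‖z‖ ≤ g ∧ l - ε < v z := by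
    by_contra! h
    rcases hg0.eq_or_lt with rfl | hg0
    · have := h 0 (by simp)
      rw [map_zero] at this
      linarith
    · have : ‖v‖ ≤ (l - ε) / g := by
        have h0 : 0 ≤ l - ε := by simpa using h 0 (by simpa using hg0.le)
        refine v.opNorm_le_of_unit_norm (by positivity) fun y hy => ?_
        have hle : ∀ y, ‖y‖ = 1 → v y ≤ (l - ε) / g := fun y hy => by
          rw [le_div_iff₀' hg0, ← smul_eq_mul, ← map_smul]
          exact h _ (by rw [norm_smul, hy, mul_one, Real.norm_of_nonneg hg0.le])
        exact abs_le'.2 ⟨hle y hy, (map_neg v y).symm.trans_le (hle _ ((norm_neg y).trans hy))⟩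
      rw [le_div_iff₀ hg0] at this
      linarith
  obtain ⟨q, hq⟩ := exists_isTailInf_asympNorm hx z
  have hq1 := hM.isTailInf_le_one hx hc hg0 hg hzg hq
  choose c hcC hcN using hq.2 ε hε
  exact ⟨z, hz, c, hcC, fun j => (hcN j).trans_le (by gcongr)⟩

theorem limsup_norm_add_le_of_weakStarNull {X : Type*} [NormedAddCommGroup X] [NormedSpace ℝ X]
    (hM : PropertyM X)
    (hR : ∀ x : ℕ → X, (∀ n, ‖x n‖ ≤ 1) → ∃ m : ℕ → ℕ, StrictMono m ∧ WeakCauchy (x ∘ m))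
    {f : ℕ → X →L[ℝ] ℝ} (hf : WeakStarNull f) {u v : X →L[ℝ] ℝ} (huv : ‖u‖ ≤ ‖v‖) {α β : ℝ}
    (hβ : ∀ᶠ n in atTop, ‖f n + v‖ < β) (hα : ∃ᶠ n in atTop, α < ‖f n + u‖) : α ≤ β := by
  by_contra! hαβ
  obtain ⟨φ, hφ, hφ'⟩ := extraction_of_frequently_atTop (hα.and_eventually hβ)
  have hβ0 : 0 < β := (norm_nonneg _).trans_lt (hφ' 0).2
  have hx : ∀ n, ∃ x : X, ‖x‖ ≤ 1 ∧ α < (f (φ n) + u) x := by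
    intro n
    by_contra! h
    refine (hφ' n).1.not_ge (ContinuousLinearMap.opNorm_le_of_unit_norm
      (hβ0.trans hαβ).le fun y hy => abs_le.2 ⟨?_, h y hy.le⟩)
    have := h (-y) (by rw [norm_neg, hy])
    rw [map_neg] at this
    linarith
  choose x hx1 hxα using hx
  obtain ⟨m, hm, hc⟩ := hR x hx1
  have hφm : Tendsto (φ ∘ m) atTop atTop := (hφ.comp hm).tendsto_atTop
  obtain ⟨l, hl⟩ := hc u
  set ε := (α - β) / (6 + β) with hε
  have hε0 : 0 < ε := div_pos (by linarith) (by linarith)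
  have hεαβ : (6 + β) * ε = α - β := mul_div_cancel₀ _ (by linarith)
  obtain ⟨z, hz, c, hcC, hcN⟩ := hM.exists_weakNull_sub (fun n => hx1 (m n)) hc huv hl hε0
  have hn : ∀ j, ∃ n ≥ j, ‖x (m n) + (z - c j)‖ < 1 + ε ∧ |f (φ (m n)) (c j)| < ε := fun j =>
    let ⟨n, h1, h2, h3⟩ := ((eventually_ge_atTop j).and
      ((eventually_lt_of_asympNorm_lt (fun n => hx1 (m n)) (hcN j)).and
      (((hf (c j)).comp hφm).norm.eventually (gt_mem_nhds (by simpa using hε0))))).exists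
    ⟨n, h1, h2, h3⟩
  choose n hnj hn1 hn2 using hn
  have hntop : Tendsto n atTop atTop := tendsto_atTop_mono hnj tendsto_id
  have e1 := ((weakNull_sub_of_mem_tailHull hc hcC hnj) v).eventually
    (lt_mem_nhds (neg_lt_zero.2 hε0))
  have e2 := ((hf z).comp (hφm.comp hntop)).eventually (lt_mem_nhds (neg_lt_zero.2 hε0))
  have e3 := (hl.comp hntop).eventually (gt_mem_nhds (lt_add_of_pos_right l hε0))
  obtain ⟨j, h1, h2, h3⟩ := (e1.and (e2.and e3)).exists
  simp only [Function.comp_apply, map_sub] at h1 h2 h3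
  have h4 := hxα (m (n j))
  rw [add_apply] at h4
  have h5 := (le_abs_self _).trans_lt (hn2 j)
  have h6 : (f (φ (m (n j))) + v) (x (m (n j)) + (z - c j)) ≤ β * (1 + ε) :=
    calc _ ≤ ‖(f (φ (m (n j))) + v) (x (m (n j)) + (z - c j))‖ := Real.le_norm_self _
      _ ≤ ‖f (φ (m (n j))) + v‖ * ‖x (m (n j)) + (z - c j)‖ := ContinuousLinearMap.le_opNorm _ _
      _ ≤ _ := by gcongr; exacts [(hφ' _).2.le, (hn1 j).le]
  simp only [add_apply, map_add, map_sub] at h6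
  linarith

theorem WeakStarNull.isBoundedUnder {X : Type*} [NormedAddCommGroup X] [NormedSpace ℝ X]
    [CompleteSpace X] {f : ℕ → X →L[ℝ] ℝ} (hf : WeakStarNull f) (v : X →L[ℝ] ℝ) :
    IsBoundedUnder (· ≤ ·) atTop fun n => ‖f n + v‖ := by
  obtain ⟨C, hC⟩ := banach_steinhaus (g := f) fun x =>
    let ⟨C, hC⟩ := (hf x).norm.bddAbove_range
    ⟨C, fun n => hC ⟨n, rfl⟩⟩
  exact isBoundedUnder_of ⟨C + ‖v‖, fun n => (norm_add_le _ _).trans (by gcongr; exact hC n)⟩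

theorem stmt9 (X : Type*) [NormedAddCommGroup X] [NormedSpace ℝ X] [CompleteSpace X]
    [TopologicalSpace.SeparableSpace X]
    (hM : PropertyM X) (hl : ¬ EmbedsIso (lp (fun _ : ℕ => ℝ) 1) X) :
    PropertyMStar X := by
  intro f hf u v huv
  by_contra! h
  obtain ⟨β, hvβ, hβu⟩ := exists_between h
  obtain ⟨α, hβα, hαu⟩ := exists_between hβu
  refine hβα.not_ge (limsup_norm_add_le_of_weakStarNull hM
    (fun x hx => exists_weaklyCauchy_subseq hl hx) hf huv
    (eventually_lt_of_limsup_lt hvβ (hf.isBoundedUnder v)) (frequently_lt_of_lt_limsup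
      (isCoboundedUnder_le_of_le atTop fun _ => norm_nonneg _) hαu))
end

section
/- Let X be a separable real Banach space whose dual X* has WORTH*. Then X* is separable. -/
open Filter Topology ZeroAtInfty

/-- If a convex set `F` of functionals satisfies `f x ≤ sup_{g ∈ F} g x` for every `x`, then `f`
can be approximated by elements of `F` on finitely many vectors. -/
theorem exists_mem_forall_abs_sub_lt {X : Type*} [NormedAddCommGroup X] [NormedSpace ℝ X]
    {F : Set (X →L[ℝ] ℝ)} (hF : Convex ℝ F) {f : X →L[ℝ] ℝ}
    (hf : ∀ x : X, ∀ ε > 0, ∃ g ∈ F, f x - ε < g x)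
    {n : ℕ} (x : Fin n → X) {ε : ℝ} (hε : 0 < ε) :
    ∃ g ∈ F, ∀ i, |g (x i) - f (x i)| < ε := by
  let T : (X →L[ℝ] ℝ) →ₗ[ℝ] (Fin n → ℝ) :=
    { toFun := fun g i => g (x i)
      map_add' := fun _ _ => rfl
      map_smul' := fun _ _ => rfl }
  have hmem : T f ∈ closure (T '' F) := by
    by_contra hn
    obtain ⟨φ, u, hu, huf⟩ :=
      geometric_hahn_banach_closed_point (hF.linear_image T).closure isClosed_closure hn
    have key : ∀ g : X →L[ℝ] ℝ, φ (T g) = g (∑ i, φ (Pi.single i 1) • x i) := by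
      intro g
      have h := LinearMap.pi_apply_eq_sum_univ φ.toLinearMap (T g)
      simp only [ContinuousLinearMap.coe_coe] at h
      rw [h, map_sum]
      refine Finset.sum_congr rfl fun i _ => ?_
      have hs : (fun j => if i = j then (1 : ℝ) else 0) = Pi.single i 1 := by
        ext j
        simp [Pi.single_apply, eq_comm]
      rw [hs, map_smul, smul_eq_mul, smul_eq_mul, mul_comm]
      rfl
    rw [key] at huf
    obtain ⟨g, hg, hgu⟩ := hf _ _ (sub_pos.2 huf)
    have h := hu (T g) (subset_closure ⟨g, hg, rfl⟩)
    rw [key] at h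
    linarith
  obtain ⟨_, ⟨g, hg, rfl⟩, hd⟩ := Metric.mem_closure_iff.1 hmem ε hε
  refine ⟨g, hg, fun i => ?_⟩
  have h := (dist_le_pi_dist (T f) (T g) i).trans_lt hd
  rwa [dist_comm, Real.dist_eq] at h

/-- A bounded sequence of functionals converging to zero on a dense sequence is weak* null. -/
theorem weakStarNull_of_denseRange {X : Type*} [NormedAddCommGroup X] [NormedSpace ℝ X]
    {u : ℕ → X} (hu : DenseRange u) {h : ℕ → (X →L[ℝ] ℝ)} {C : ℝ} (hC : ∀ n, ‖h n‖ ≤ C)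
    (hh : ∀ k, Tendsto (fun n => h n (u k)) atTop (nhds 0)) : WeakStarNull h := by
  intro x
  have hC0 : 0 ≤ C := (norm_nonneg _).trans (hC 0)
  rw [Metric.tendsto_nhds]
  intro ε hε
  obtain ⟨k, hk⟩ := hu.exists_dist_lt x (show 0 < ε / (2 * (C + 1)) by positivity)
  filter_upwards [(Metric.tendsto_nhds.1 (hh k)) (ε / 2) (half_pos hε)] with n hn
  rw [dist_zero_right] at hn ⊢
  have h1 : ‖h n (x - u k)‖ ≤ C * ‖x - u k‖ :=
    ((h n).le_opNorm _).trans (by gcongr; exact hC n)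
  have h2 : (C + 1) * ‖x - u k‖ < ε / 2 := by
    rw [dist_eq_norm, lt_div_iff₀ (by positivity)] at hk
    linarith
  have h3 : h n x = h n (x - u k) + h n (u k) := by simp
  have h4 := norm_add_le (h n (x - u k)) (h n (u k))
  rw [← h3] at h4
  have h5 := norm_nonneg (x - u k)
  linarith

/-- In the dual of a separable space, some sequence in the unit ball is norming. -/
theorem exists_seq_norming (X : Type*) [NormedAddCommGroup X] [NormedSpace ℝ X]
    [TopologicalSpace.SeparableSpace X] :
    ∃ φ : ℕ → (X →L[ℝ] ℝ), (∀ k, ‖φ k‖ ≤ 1) ∧ ∀ x : X, ∀ ε > 0, ∃ k, ‖x‖ - ε < φ k x := by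
  choose φ hφ hφu using fun k : ℕ => exists_dual_vector'' ℝ (TopologicalSpace.denseSeq X k)
  refine ⟨φ, hφ, fun x ε hε => ?_⟩
  obtain ⟨k, hk⟩ := (TopologicalSpace.denseRange_denseSeq X).exists_dist_lt x (half_pos hε)
  refine ⟨k, ?_⟩
  set y := TopologicalSpace.denseSeq X k
  rw [dist_eq_norm] at hk
  have h1 : ‖φ k (x - y)‖ ≤ 1 * ‖x - y‖ := (φ k).le_of_opNorm_le (hφ k) _
  have h2 : φ k y = ‖y‖ := hφu k
  have h3 := norm_sub_norm_le x y
  rw [map_sub, Real.norm_eq_abs] at h1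
  have h4 := (abs_le.1 h1).1
  linarith

/-- If the convex set `F` of functionals is bounded and `f ≤ sup F` pointwise, then `f` is the
weak* limit of a sequence in `F` when the space is separable. -/
theorem exists_seq_weakStarNull_sub {X : Type*} [NormedAddCommGroup X] [NormedSpace ℝ X]
    [TopologicalSpace.SeparableSpace X] {F : Set (X →L[ℝ] ℝ)} (hF : Convex ℝ F) {C : ℝ}
    (hC : ∀ g ∈ F, ‖g‖ ≤ C) {f : X →L[ℝ] ℝ}
    (hf : ∀ x : X, ∀ ε > 0, ∃ g ∈ F, f x - ε < g x) :
    ∃ g : ℕ → (X →L[ℝ] ℝ), (∀ n, g n ∈ F) ∧ WeakStarNull (fun n => g n - f) := by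
  choose g hgF hg using fun n : ℕ => exists_mem_forall_abs_sub_lt hF hf
    (fun i : Fin n => TopologicalSpace.denseSeq X i) (Nat.one_div_pos_of_nat (α := ℝ) (n := n))
  refine ⟨g, hgF, weakStarNull_of_denseRange (TopologicalSpace.denseRange_denseSeq X)
    (C := C + ‖f‖) (fun n => (norm_sub_le _ _).trans (by gcongr; exact hC _ (hgF n)))
    fun k => ?_⟩
  refine squeeze_zero_norm' ?_ tendsto_one_div_add_atTop_nhds_zero_nat
  filter_upwards [eventually_gt_atTop k] with n hn
  exact (hg n ⟨k, hn⟩).le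

theorem stmt11 (X : Type*) [NormedAddCommGroup X] [NormedSpace ℝ X] [CompleteSpace X]
    [TopologicalSpace.SeparableSpace X]
    (hW : WORTHStar X) :
    TopologicalSpace.SeparableSpace (X →L[ℝ] ℝ) := by
  obtain ⟨φ, hφ, hnorming⟩ := exists_seq_norming X
  let M : Submodule ℝ (X →L[ℝ] ℝ) := (Submodule.span ℝ (Set.range φ)).topologicalClosure
  have hφM : ∀ k, φ k ∈ M := fun k =>
    Submodule.le_topologicalClosure _ (Submodule.subset_span ⟨k, rfl⟩)
  have hMsep : TopologicalSpace.IsSeparable (M : Set (X →L[ℝ] ℝ)) :=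
    ((Set.countable_range φ).isSeparable.span (R := ℝ)).closure
  suffices hM : ∀ f, f ∈ M from
    TopologicalSpace.isSeparable_univ_iff.1 (hMsep.mono fun f _ => hM f)
  by_contra! hM
  obtain ⟨f, hfM, hf⟩ := riesz_lemma (Submodule.isClosed_topologicalClosure _) hM
    (show (3 / 4 : ℝ) < 1 by norm_num)
  have hf0 : 0 < ‖f‖ := norm_pos_iff.2 fun h => hfM (h ▸ M.zero_mem)
  obtain ⟨g, hg, hgf⟩ := exists_seq_weakStarNull_sub (f := f) (C := ‖f‖)
    (M.convex.inter (convex_closedBall 0 ‖f‖)) (fun g hg => by simpa using hg.2) (by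
      intro x ε hε
      obtain ⟨k, hk⟩ := hnorming x (ε / ‖f‖) (div_pos hε hf0)
      refine ⟨‖f‖ • φ k, ⟨M.smul_mem _ (hφM k), ?_⟩, ?_⟩
      · simpa [norm_smul] using mul_le_mul_of_nonneg_left (hφ k) hf0.le
      · have h1 := (le_abs_self _).trans (f.le_opNorm x)
        have h2 := mul_lt_mul_of_pos_left hk hf0
        rw [mul_sub, mul_div_cancel₀ _ hf0.ne'] at h2
        simp only [smul_apply, smul_eq_mul]
        linarith)
  obtain ⟨n, hn⟩ := ((hW _ hgf f).eventually_lt_const (half_pos hf0)).exists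
  have h1 : ‖g n‖ ≤ ‖f‖ := by simpa using (hg n).2
  have h2 := hf ((1 / 2 : ℝ) • g n) (M.smul_mem _ (hg n).1)
  have h3 : g n - f - f = (-2 : ℝ) • (f - (1 / 2 : ℝ) • g n) := by module
  rw [h3, norm_smul, sub_add_cancel] at hn
  norm_num at hn h2
  linarith
end

section
/- Let X be a separable real Banach space whose dual X* has WORTH*. Then c₀ does not embed isomorphically into X* and ℓ₁ does not embed isomorphically into X. -/
open Filter Topology ZeroAtInfty

/-- Finitely many evaluations of a functional in the dual unit ball can be approximated by elements
of the unit ball of any norming subspace. -/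
theorem exists_norming_approx {E ι : Type*} [NormedAddCommGroup E] [NormedSpace ℝ E] [Fintype ι]
    (V : Submodule ℝ (E →L[ℝ] ℝ))
    (hV : ∀ x : E, ∀ ε > 0, ∃ g ∈ V, ‖g‖ ≤ 1 ∧ ‖x‖ - ε ≤ g x)
    {f : E →L[ℝ] ℝ} (hf : ‖f‖ ≤ 1) (x : ι → E) {ε : ℝ} (hε : 0 < ε) :
    ∃ g ∈ V, ‖g‖ ≤ 1 ∧ ∀ i, |g (x i) - f (x i)| < ε := by
  classical
  let L : (E →L[ℝ] ℝ) →ₗ[ℝ] (ι → ℝ) :=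
    LinearMap.pi fun i => (ContinuousLinearMap.apply ℝ ℝ (x i)).toLinearMap
  have hL : ∀ g i, L g i = g (x i) := fun g i => rfl
  let S : Set (E →L[ℝ] ℝ) := (V : Set (E →L[ℝ] ℝ)) ∩ Metric.closedBall 0 1
  have hS : Convex ℝ S := V.convex.inter (convex_closedBall 0 1)
  have hmem : L f ∈ closure (L '' S) := by
    by_contra hnot
    obtain ⟨φ, u, hφ, hu⟩ :=
      geometric_hahn_banach_closed_point (hS.linear_image L).closure isClosed_closure hnot
    let z : E := ∑ i, φ (fun j => if i = j then 1 else 0) • x i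
    have hφL : ∀ g : E →L[ℝ] ℝ, φ (L g) = g z := by
      intro g
      have h := LinearMap.pi_apply_eq_sum_univ φ.toLinearMap (L g)
      simp only [ContinuousLinearMap.coe_coe, hL, smul_eq_mul] at h
      rw [h]
      simp [z, map_sum, mul_comm]
    have hfz : u < ‖z‖ := by
      rw [hφL] at hu
      calc u < f z := hu
        _ ≤ ‖f z‖ := le_abs_self _
        _ ≤ ‖z‖ := f.le_of_opNorm_le hf z |>.trans_eq (one_mul _)
    obtain ⟨g, hgV, hg1, hgz⟩ := hV z (‖z‖ - u) (by linarith)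
    have := hφ (L g) (subset_closure ⟨g, ⟨hgV, by simpa using hg1⟩, rfl⟩)
    rw [hφL] at this
    linarith
  obtain ⟨_, ⟨g, ⟨hgV, hg1⟩, rfl⟩, hd⟩ := Metric.mem_closure_iff.1 hmem ε hε
  refine ⟨g, hgV, by simpa using hg1, fun i => ?_⟩
  have := (dist_pi_lt_iff hε).1 hd i
  rwa [hL, hL, dist_comm, Real.dist_eq] at this

/-- In the dual of a separable space, the unit ball of a norming subspace is weak* sequentially
dense in the dual unit ball. -/
theorem exists_seq_norming_s12 {E : Type*} [NormedAddCommGroup E] [NormedSpace ℝ E]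
    [TopologicalSpace.SeparableSpace E] (V : Submodule ℝ (E →L[ℝ] ℝ))
    (hV : ∀ x : E, ∀ ε > 0, ∃ g ∈ V, ‖g‖ ≤ 1 ∧ ‖x‖ - ε ≤ g x)
    {f : E →L[ℝ] ℝ} (hf : ‖f‖ ≤ 1) :
    ∃ g : ℕ → (E →L[ℝ] ℝ), (∀ n, g n ∈ V) ∧ (∀ n, ‖g n‖ ≤ 1) ∧
      WeakStarNull fun n => g n - f := by
  have hex : ∀ n : ℕ, ∃ g ∈ V, ‖g‖ ≤ 1 ∧ ∀ i : Fin n,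
      |g (TopologicalSpace.denseSeq E i) - f (TopologicalSpace.denseSeq E i)| < 1 / ((n : ℝ) + 1) :=
    fun n => exists_norming_approx V hV hf (fun i : Fin n => TopologicalSpace.denseSeq E i)
      Nat.one_div_pos_of_nat
  choose g hgV hg1 hg using hex
  refine ⟨g, hgV, hg1, fun x => ?_⟩
  rw [Metric.tendsto_atTop]
  intro ε hε
  obtain ⟨k, hk⟩ := (TopologicalSpace.denseRange_denseSeq E).exists_dist_lt x
    (show 0 < ε / 4 by positivity)
  obtain ⟨N, hN⟩ := exists_nat_one_div_lt (show 0 < ε / 2 by positivity)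
  refine ⟨max N (k + 1), fun n hn => ?_⟩
  have hnN : N ≤ n := (le_max_left _ _).trans hn
  have hkn : k < n := (le_max_right _ _).trans hn
  set y := TopologicalSpace.denseSeq E k
  have h1 : |(g n - f) y| < ε / 2 :=
    (hg n ⟨k, hkn⟩).trans ((Nat.one_div_le_one_div hnN).trans_lt hN)
  have h2 : ‖(g n - f) (x - y)‖ ≤ 2 * ‖x - y‖ :=
    (g n - f).le_of_opNorm_le ((norm_sub_le _ _).trans (by linarith [hg1 n])) _
  rw [dist_eq_norm] at hk
  have h3 : (g n - f) x = (g n - f) (x - y) + (g n - f) y := by rw [← map_add, sub_add_cancel]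
  rw [Real.dist_eq, sub_zero, h3]
  rw [Real.norm_eq_abs] at h2
  exact (abs_add_le _ _).trans_lt (by linarith)

/-- If the dual of a separable space has WORTH*, every closed norming subspace is the whole dual. -/
theorem WORTHStar.eq_top_of_norming {E : Type*} [NormedAddCommGroup E] [NormedSpace ℝ E]
    [TopologicalSpace.SeparableSpace E] (hW : WORTHStar E) (V : Submodule ℝ (E →L[ℝ] ℝ))
    (hVc : IsClosed (V : Set (E →L[ℝ] ℝ)))
    (hV : ∀ x : E, ∀ ε > 0, ∃ g ∈ V, ‖g‖ ≤ 1 ∧ ‖x‖ - ε ≤ g x) : V = ⊤ := by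
  by_contra hne
  obtain ⟨f₀, hf₀⟩ : ∃ f, f ∉ V := by
    by_contra! h
    exact hne (Submodule.eq_top_iff'.2 h)
  obtain ⟨f₁, hf₁, hd⟩ := riesz_lemma hVc ⟨f₀, hf₀⟩ (show (4 / 5 : ℝ) < 1 by norm_num)
  have hpos : 0 < ‖f₁‖ := norm_pos_iff.2 fun h => hf₁ (h ▸ V.zero_mem)
  set f := ‖f₁‖⁻¹ • f₁
  have hf : ‖f‖ = 1 := by simp [f, norm_smul, hpos.ne']
  have hff₁ : f₁ = ‖f₁‖ • f := by simp [f, smul_smul, hpos.ne']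
  obtain ⟨g, hgV, hg1, hg⟩ := exists_seq_norming_s12 V hV hf.le
  obtain ⟨n, hn⟩ := ((hW _ hg f).eventually_lt_const (show (0 : ℝ) < 1 / 2 by norm_num)).exists
  rw [sub_add_cancel] at hn
  have hmem : (‖f₁‖ / 2) • g n ∈ V := V.smul_mem _ (hgV n)
  have h := hd _ hmem
  have heq : f₁ - (‖f₁‖ / 2) • g n = -(‖f₁‖ / 2) • (g n - f - f) := by
    nth_rewrite 1 [hff₁]
    module
  rw [heq, norm_smul, norm_neg, Real.norm_of_nonneg (by positivity)] at h
  nlinarith [hg1 n]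

/-- The dual of a separable space is separable as soon as it has WORTH*. -/
theorem WORTHStar.separableSpace_dual {E : Type*} [NormedAddCommGroup E] [NormedSpace ℝ E]
    [TopologicalSpace.SeparableSpace E] (hW : WORTHStar E) :
    TopologicalSpace.SeparableSpace (E →L[ℝ] ℝ) := by
  choose φ hφ1 hφ using fun k : ℕ => exists_dual_vector'' ℝ (TopologicalSpace.denseSeq E k)
  let V := (Submodule.span ℝ (Set.range φ)).topologicalClosure
  have hsep : TopologicalSpace.IsSeparable (V : Set (E →L[ℝ] ℝ)) := by
    rw [Submodule.topologicalClosure_coe]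
    exact ((Set.countable_range φ).isSeparable.span (R := ℝ)).closure
  have htop : V = ⊤ := by
    refine hW.eq_top_of_norming V (Submodule.isClosed_topologicalClosure _) fun x ε hε => ?_
    obtain ⟨k, hk⟩ := (TopologicalSpace.denseRange_denseSeq E).exists_dist_lt x (half_pos hε)
    refine ⟨φ k, Submodule.le_topologicalClosure _ (Submodule.subset_span ⟨k, rfl⟩), hφ1 k, ?_⟩
    set y := TopologicalSpace.denseSeq E k
    rw [dist_eq_norm] at hk
    have h1 : φ k y = ‖y‖ := hφ k
    have h2 : ‖φ k (x - y)‖ ≤ 1 * ‖x - y‖ := (φ k).le_of_opNorm_le (hφ1 k) _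
    rw [Real.norm_eq_abs, map_sub] at h2
    have h3 := (abs_le.1 h2).1
    have h4 : ‖x‖ - ‖y‖ ≤ ‖x - y‖ := norm_sub_norm_le x y
    linarith
  rw [htop, Submodule.top_coe] at hsep
  exact TopologicalSpace.isSeparable_univ_iff.1 hsep

/-- A weakly unconditionally Cauchy sequence in a separable dual has terms of arbitrarily small
norm. -/
theorem exists_norm_lt_of_separable_dual {E : Type*} [NormedAddCommGroup E] [NormedSpace ℝ E]
    [TopologicalSpace.SeparableSpace (E →L[ℝ] ℝ)] (y : ℕ → (E →L[ℝ] ℝ)) {C : ℝ}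
    (hy : ∀ x (s : Finset ℕ), ∑ n ∈ s, |y n x| ≤ C * ‖x‖) {ε : ℝ} (hε : 0 < ε) :
    ∃ n, ‖y n‖ < ε := by
  have hsum : ∀ x, Summable fun n => |y n x| := fun x =>
    summable_of_sum_le (fun _ => abs_nonneg _) (hy x)
  have hle : ∀ (A : ℕ → Bool) x n, ‖if A n then y n x else 0‖ ≤ |y n x| := by
    intro A x n
    split_ifs <;> simp
  have hsumA : ∀ (A : ℕ → Bool) x, Summable fun n => if A n then y n x else 0 := fun A x =>
    Summable.of_norm_bounded (hsum x) (hle A x)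
  let G : (ℕ → Bool) → (E →L[ℝ] ℝ) := fun A =>
    LinearMap.mkContinuous
      { toFun := fun x => ∑' n, if A n then y n x else 0
        map_add' := fun x z => by
          rw [← (hsumA A x).tsum_add (hsumA A z)]
          exact tsum_congr fun n => by split_ifs <;> simp
        map_smul' := fun c x => by
          rw [RingHom.id_apply, smul_eq_mul, ← tsum_mul_left]
          exact tsum_congr fun n => by split_ifs <;> simp }
      C fun x => (tsum_of_norm_bounded (hsum x).hasSum (hle A x)).trans
        ((hsum x).tsum_le_of_sum_le (hy x))
  have hG : ∀ A x, G A x = ∑' n, if A n then y n x else 0 := fun A x => rfl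
  have hcont : ∀ x, Continuous fun A => G A x := by
    intro x
    simp only [hG]
    refine continuous_tsum (fun n => ?_) (hsum x) fun n A => hle A x n
    exact (continuous_of_discreteTopology (f := fun b : Bool => if b then y n x else 0)).comp
      (continuous_apply n)
  let K : ℕ → Set (ℕ → Bool) := fun k =>
    {A | ∀ x, ‖G A x - TopologicalSpace.denseSeq (E →L[ℝ] ℝ) k x‖ ≤ ε / 3 * ‖x‖}
  have hK : ∀ k, IsClosed (K k) := by
    intro k
    simp only [K, Set.ofPred_forall]
    exact isClosed_iInter fun x =>
      isClosed_le ((hcont x).sub continuous_const).norm continuous_const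
  have hKU : ⋃ k, K k = Set.univ := by
    refine Set.eq_univ_of_forall fun A => Set.mem_iUnion.2 ?_
    obtain ⟨k, hk⟩ := (TopologicalSpace.denseRange_denseSeq (E →L[ℝ] ℝ)).exists_dist_lt (G A)
      (show 0 < ε / 3 by positivity)
    rw [dist_eq_norm] at hk
    exact ⟨k, fun x => (G A - _).le_of_opNorm_le hk.le x⟩
  obtain ⟨k, A, hA⟩ := nonempty_interior_of_iUnion_of_closed hK hKU
  have hev : ∀ b : Bool, ∀ᶠ n in atTop, Function.update A n b ∈ K k := by
    intro b
    have ht : Tendsto (fun n => Function.update A n b) atTop (𝓝 A) := by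
      refine tendsto_pi_nhds.2 fun i => tendsto_const_nhds.congr' ?_
      filter_upwards [eventually_gt_atTop i] with n hn
      rw [Function.update_of_ne hn.ne]
    exact ht.eventually (mem_interior_iff_mem_nhds.1 hA)
  obtain ⟨n, ht, hf⟩ := ((hev true).and (hev false)).exists
  refine ⟨n, lt_of_le_of_lt (ContinuousLinearMap.opNorm_le_bound _ (M := 2 * (ε / 3))
    (by positivity) fun x => ?_) (by linarith)⟩
  have hdiff : y n x = G (Function.update A n true) x - G (Function.update A n false) x := by
    rw [hG, hG, ← (hsumA _ x).tsum_sub (hsumA _ x), tsum_eq_single n]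
    · simp
    · intro m hm
      simp [Function.update_of_ne hm]
  rw [hdiff, ← sub_sub_sub_cancel_right _ _ (TopologicalSpace.denseSeq (E →L[ℝ] ℝ) k x)]
  exact (norm_sub_le _ _).trans (by linarith [ht x, hf x])

/-- The element of `c₀` that agrees with `a` on the finite set `s` and vanishes elsewhere. -/
noncomputable def c0OfFinset (s : Finset ℕ) (a : ℕ → ℝ) : C₀(ℕ, ℝ) where
  toFun n := if n ∈ s then a n else 0
  continuous_toFun := continuous_of_discreteTopology
  zero_at_infty' := by
    rw [cocompact_eq_cofinite]
    refine tendsto_const_nhds.congr' ?_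
    filter_upwards [s.finite_toSet.eventually_cofinite_notMem] with n hn
    rw [if_neg (by simpa using hn)]

theorem c0OfFinset_apply (s : Finset ℕ) (a : ℕ → ℝ) (n : ℕ) :
    c0OfFinset s a n = if n ∈ s then a n else 0 := rfl

theorem norm_c0OfFinset_le (s : Finset ℕ) {a : ℕ → ℝ} (ha : ∀ n, |a n| ≤ 1) :
    ‖c0OfFinset s a‖ ≤ 1 := by
  rw [← ZeroAtInftyContinuousMap.norm_toBCF_eq_norm]
  refine (BoundedContinuousFunction.norm_le zero_le_one).2 fun n => ?_
  change |c0OfFinset s a n| ≤ 1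
  rw [c0OfFinset_apply]
  split_ifs
  · exact ha n
  · simp

theorem c0OfFinset_eq_sum (s : Finset ℕ) (a : ℕ → ℝ) :
    c0OfFinset s a = ∑ n ∈ s, a n • c0OfFinset {n} 1 := by
  classical
  induction s using Finset.induction_on with
  | empty => ext m; simp [c0OfFinset_apply]
  | insert k s hk ih =>
    rw [Finset.sum_insert hk, ← ih]
    ext m
    by_cases hm : m = k
    · subst hm; simp [c0OfFinset_apply, hk]
    · simp [c0OfFinset_apply, hm]

theorem one_le_norm_c0OfFinset_singleton (n : ℕ) : 1 ≤ ‖c0OfFinset {n} 1‖ := by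
  rw [← ZeroAtInftyContinuousMap.norm_toBCF_eq_norm]
  refine le_trans (le_of_eq ?_) ((c0OfFinset {n} 1).toBCF.norm_coe_le_norm n)
  change 1 = |c0OfFinset {n} 1 n|
  simp [c0OfFinset_apply]

/-- A separable dual contains no isomorphic copy of `c₀`. -/
theorem not_embedsIso_c0_dual {E : Type*} [NormedAddCommGroup E] [NormedSpace ℝ E]
    [TopologicalSpace.SeparableSpace (E →L[ℝ] ℝ)] : ¬ EmbedsIso C₀(ℕ, ℝ) (E →L[ℝ] ℝ) := by
  rintro ⟨T, -, c, hc, hT⟩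
  obtain ⟨n, hn⟩ := exists_norm_lt_of_separable_dual (fun n => T (c0OfFinset {n} 1)) (C := ‖T‖)
    (fun x s => by
      let a : ℕ → ℝ := fun n => SignType.sign (T (c0OfFinset {n} 1) x)
      have ha : ∀ n, |a n| ≤ 1 := fun n => by
        rcases lt_trichotomy (T (c0OfFinset {n} 1) x) 0 with h | h | h <;> simp [a, h]
      have hsum : ∑ n ∈ s, |T (c0OfFinset {n} 1) x| = T (c0OfFinset s a) x := by
        rw [c0OfFinset_eq_sum, map_sum, sum_apply]
        refine Finset.sum_congr rfl fun n _ => ?_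
        rw [map_smul, smul_apply, smul_eq_mul, sign_mul_self]
      rw [hsum]
      refine (le_abs_self _).trans ((T _).le_of_opNorm_le ?_ x)
      exact T.le_opNorm_of_le (norm_c0OfFinset_le s ha) |>.trans_eq (mul_one _)) hc
  have h1 := hT (c0OfFinset {n} 1)
  have h2 := one_le_norm_c0OfFinset_singleton n
  nlinarith

/-- A bounded functional extends along an isomorphic embedding. -/
theorem exists_extension_of_bounded_below {F E : Type*} [NormedAddCommGroup F] [NormedSpace ℝ F]
    [NormedAddCommGroup E] [NormedSpace ℝ E] (T : F →L[ℝ] E) {c : ℝ} (hc : 0 < c)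
    (hT : ∀ y, c * ‖y‖ ≤ ‖T y‖) (φ : F →L[ℝ] ℝ) : ∃ f : E →L[ℝ] ℝ, ∀ y, f (T y) = φ y := by
  have hinj : Function.Injective T.toLinearMap := by
    refine (injective_iff_map_eq_zero _).2 fun y hy => ?_
    have := hT y
    rw [show T y = 0 from hy, norm_zero] at this
    exact norm_le_zero_iff.1 (by nlinarith [norm_nonneg y])
  let e := LinearEquiv.ofInjective T.toLinearMap hinj
  let ψ : LinearMap.range T.toLinearMap →L[ℝ] ℝ :=
    (φ.toLinearMap ∘ₗ e.symm.toLinearMap).mkContinuous (‖φ‖ * c⁻¹) fun z => by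
      obtain ⟨y, rfl⟩ := e.surjective z
      have h1 : ‖y‖ ≤ c⁻¹ * ‖T y‖ := by
        rw [inv_mul_eq_div, le_div_iff₀ hc, mul_comm]
        exact hT y
      have h2 : ‖e y‖ = ‖T y‖ := rfl
      rw [h2, mul_assoc]
      simpa using (φ.le_opNorm y).trans (mul_le_mul_of_nonneg_left h1 (norm_nonneg φ))
  obtain ⟨f, hf, -⟩ := exists_extension_norm_eq _ ψ
  refine ⟨f, fun y => ?_⟩
  have h : ψ (e y) = φ y := by simp [ψ]
  rw [← h, ← hf]
  rfl

/-- Every `0`-`1` sequence is the sequence of coefficients of a bounded functional on `ℓ₁`. -/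
theorem exists_dual_l1 (A : ℕ → Bool) :
    ∃ φ : lp (fun _ : ℕ => ℝ) 1 →L[ℝ] ℝ,
      ∀ n, φ (lp.single 1 n (1 : ℝ)) = if A n then 1 else 0 := by
  have hsum : ∀ x : lp (fun _ : ℕ => ℝ) 1, HasSum (fun n => ‖x n‖) ‖x‖ := fun x => by
    simpa using lp.hasSum_norm (p := 1) (by simp) x
  have hle : ∀ (x : lp (fun _ : ℕ => ℝ) 1) n, ‖if A n then x n else 0‖ ≤ ‖x n‖ := by
    intro x n
    split_ifs <;> simp
  have hsumA : ∀ x : lp (fun _ : ℕ => ℝ) 1, Summable fun n => if A n then x n else 0 := fun x =>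
    Summable.of_norm_bounded (hsum x).summable (hle x)
  refine ⟨LinearMap.mkContinuous
      { toFun := fun x => ∑' n, if A n then x n else 0
        map_add' := fun x z => by
          rw [← (hsumA x).tsum_add (hsumA z)]
          exact tsum_congr fun n => by split_ifs <;> simp
        map_smul' := fun c x => by
          rw [RingHom.id_apply, smul_eq_mul, ← tsum_mul_left]
          exact tsum_congr fun n => by split_ifs <;> simp }
      1 fun x => (tsum_of_norm_bounded (hsum x) (hle x)).trans_eq (one_mul _).symm, fun n => ?_⟩
  change (∑' m, if A m then lp.single 1 n (1 : ℝ) m else 0) = _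
  rw [tsum_eq_single n]
  · simp
  · intro m hm
    simp [hm]

/-- A space with separable dual contains no isomorphic copy of `ℓ₁`. -/
theorem not_embedsIso_l1 {E : Type*} [NormedAddCommGroup E] [NormedSpace ℝ E]
    [TopologicalSpace.SeparableSpace (E →L[ℝ] ℝ)] :
    ¬ EmbedsIso (lp (fun _ : ℕ => ℝ) 1) E := by
  rintro ⟨T, -, c, hc, hT⟩
  choose φ hφ using exists_dual_l1
  choose f hf using fun A => exists_extension_of_bounded_below T hc hT (φ A)
  set e : ℕ → lp (fun _ : ℕ => ℝ) 1 := fun n => lp.single 1 n (1 : ℝ)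
  have he : ∀ n, ‖T (e n)‖ ≤ ‖T‖ := fun n =>
    (T.le_opNorm_of_le (lp.norm_single (p := 1) (by simp) n (1 : ℝ)).le).trans (by simp)
  have hε : 0 < (1 : ℝ) / (2 * (‖T‖ + 1)) := by positivity
  choose k hk using fun A =>
    (TopologicalSpace.denseRange_denseSeq (E →L[ℝ] ℝ)).exists_dist_lt (f A) hε
  have hinj : Function.Injective k := by
    intro A B hAB
    by_contra hne
    obtain ⟨n, hn⟩ := Function.ne_iff.1 hne
    have hdist : ‖f A - f B‖ < 1 / (‖T‖ + 1) := by
      rw [← dist_eq_norm]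
      calc dist (f A) (f B) ≤ _ := dist_triangle_right _ _ _
        _ < 1 / (2 * (‖T‖ + 1)) + 1 / (2 * (‖T‖ + 1)) := add_lt_add (hk A) (hAB ▸ hk B)
        _ = 1 / (‖T‖ + 1) := by field_simp; norm_num
    have h1 : ‖(f A - f B) (T (e n))‖ = 1 := by
      rw [sub_apply, hf, hf, hφ, hφ]
      revert hn
      cases A n <;> cases B n <;> simp
    have h2 := (f A - f B).le_opNorm (T (e n))
    rw [h1] at h2
    rw [lt_div_iff₀ (by positivity)] at hdist
    nlinarith [he n, norm_nonneg (f A - f B), norm_nonneg T]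
  classical
  refine Function.cantor_injective (fun S : Set ℕ => k fun n => decide (n ∈ S)) fun S S' h => ?_
  ext n
  simpa using congrFun (hinj h) n

theorem stmt12 (X : Type*) [NormedAddCommGroup X] [NormedSpace ℝ X] [CompleteSpace X]
    [TopologicalSpace.SeparableSpace X]
    (hW : WORTHStar X) :
    ¬ EmbedsIso C₀(ℕ, ℝ) (X →L[ℝ] ℝ) ∧ ¬ EmbedsIso (lp (fun _ : ℕ => ℝ) 1) X := by
  have := hW.separableSpace_dual
  exact ⟨not_embedsIso_c0_dual, not_embedsIso_l1⟩
end
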